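/- arXiv:2204.13441 — 9 statements merged into one kernel-verified Lean document; each statement's English description precedes it below -/
import Mathlib

section
/- There exists an absolutely maximally entangled state of four subsystems with six levels each (an AME(4,6) state): there is a pure state ψ : (Fin 4 → Fin 6) → ℂ with ∑_x |ψ(x)|² = 1 such that for every subset S ⊆ Fin 4 with |S| = 2 the reduced density matrix satisfies ρ_S(ψ) = (1/36)·Identity. Equivalently, there exists a 2-unitary matrix of order 36, i.e. a quantum solution to Euler's problem of 36 officers. -/
open scoped ComplexConjugate

/-- Glue a function on `S` and a function on `Sᶜ` into a function on all parties. -/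
def glue {N d : ℕ} (S : Finset (Fin N)) (x : {i // i ∈ S} → Fin d)
    (z : {i // i ∈ Sᶜ} → Fin d) : Fin N → Fin d :=
  fun i => if h : i ∈ S then x ⟨i, h⟩ else z ⟨i, Finset.mem_compl.mpr h⟩

/-- Reduced density matrix of `ψ` on the subset `S` of parties. -/
noncomputable def rdm {N d : ℕ} (S : Finset (Fin N)) (ψ : (Fin N → Fin d) → ℂ) :
    Matrix ({i // i ∈ S} → Fin d) ({i // i ∈ S} → Fin d) ℂ :=
  fun x y => ∑ z : {i // i ∈ Sᶜ} → Fin d, ψ (glue S x z) * conj (ψ (glue S y z))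

namespace AME46

/-- The coefficients `(a, b)` of the Eisenstein integers `a + b ω` which, at `(p, m)`, are the
discrete Fourier transforms `∑ q, ω ^ e(p, q) * exp (2πi q m / 6)` of an array of cube roots of
unity. -/
def coeff (p m : Fin 6) : ℤ × ℤ :=
  (![![-2, 0, 1, 0, -2, -3],
     ![1, -3, -2, -3, 1, 0],
     ![-2, 0, 4, 0, -2, 0],
     ![-2, 0, 1, 0, -2, 3],
     ![1, -3, -2, -3, 1, 0],
     ![-2, 0, -2, 0, -2, 0]] p m,
   ![![-1, -3, 2, -3, -1, 0],
     ![-1, -3, -1, -3, -1, 3],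
     ![2, 0, 2, 0, 2, 0],
     ![-1, 3, 2, 3, -1, 0],
     ![-1, -3, -1, -3, -1, 3],
     ![-4, 0, 2, 0, -4, 0]] p m)

/-- The product `(a + b ω) * conj (c + d ω)` of Eisenstein integers. -/
def mulConj (x y : ℤ × ℤ) : ℤ × ℤ :=
  (x.1 * y.1 - x.1 * y.2 + x.2 * y.2, x.2 * y.1 - x.1 * y.2)

/-- The primitive cube root of unity `exp (2πi / 3)`. -/
noncomputable def omega : ℂ := ⟨-1 / 2, √3 / 2⟩

/-- The complex number `a + b ω` attached to a pair of integers. -/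
noncomputable def toComplex (x : ℤ × ℤ) : ℂ := x.1 + x.2 * omega

lemma conj_omega : conj omega = -1 - omega := by
  apply Complex.ext
  · simp [omega]
    ring
  · simp [omega]

lemma omega_mul_omega : omega * omega = -1 - omega := by
  have h : √3 * √3 = 3 := Real.mul_self_sqrt (by norm_num)
  apply Complex.ext <;> simp [omega] <;> linarith

lemma toComplex_mul_conj (x y : ℤ × ℤ) :
    toComplex x * conj (toComplex y) = toComplex (mulConj x y) := by
  simp only [toComplex, mulConj, map_add, map_mul, map_intCast, conj_omega]
  push_cast
  linear_combination (-(x.2 : ℂ) * y.2) * omega_mul_omega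

lemma toComplex_sum (f : Fin 6 → ℤ × ℤ) :
    toComplex (∑ t, f t) = ∑ t, toComplex (f t) := by
  simp [toComplex, Prod.fst_sum, Prod.snd_sum, Finset.sum_add_distrib, Finset.sum_mul]

/-- The amplitudes of the state. -/
noncomputable def amp (i j k l : Fin 6) : ℂ :=
  if i + l = j + k then toComplex (coeff (i - j) (j - l)) / 36 else 0

lemma amp_eq {i j k l s t : Fin 6} {x : ℤ × ℤ} (hst : i + l = j + k ↔ s = t)
    (hx : s = t → coeff (i - j) (j - l) = x) :
    amp i j k l = if s = t then toComplex x / 36 else 0 := by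
  unfold amp
  simp only [hst]
  split_ifs with h
  · rw [hx h]
  · rfl

/-- A double sum of products of amplitudes collapses onto the common support. -/
lemma sum_support (u v : Fin 6 → Fin 6) (x y : Fin 6 → ℤ × ℤ) (α β : Fin 6 → Fin 6 → ℂ)
    (hα : ∀ s t, α s t = if s = u t then toComplex (x t) / 36 else 0)
    (hβ : ∀ s t, β s t = if s = v t then toComplex (y t) / 36 else 0)
    (C D : Prop) [Decidable C] [Decidable D] (huv : ∀ t, u t = v t ↔ C)
    (hDC : D → C)
    (h : C → ∑ t, mulConj (x t) (y t) = if D then (36, 0) else 0) :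
    ∑ s, ∑ t, α s t * conj (β s t) = if D then (36 : ℂ)⁻¹ else 0 := by
  have hcollapse : ∀ t, ∑ s, α s t * conj (β s t) =
      if C then toComplex (mulConj (x t) (y t)) / 1296 else 0 := by
    intro t
    rw [Finset.sum_eq_single (u t)]
    · rw [hα, hβ, if_pos rfl]
      simp only [huv t]
      split_ifs
      · rw [← toComplex_mul_conj, map_div₀, Complex.conj_ofNat]
        ring
      · simp
    · intro s _ hs
      simp [hα, hs]
    · simp
  rw [Finset.sum_comm, Finset.sum_congr rfl fun t _ => hcollapse t]
  by_cases hC : C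
  · simp only [if_pos hC]
    rw [← Finset.sum_div, ← toComplex_sum, h hC]
    split_ifs <;> simp [toComplex]
    norm_num
  · have hD : ¬D := fun hD => hC (hDC hD)
    simp [hC, hD]

set_option maxRecDepth 10000 in
/-- Orthogonality along the rows of `coeff`. -/
lemma sum_mulConj_row : ∀ p d : Fin 6,
    ∑ m, mulConj (coeff p m) (coeff p (m + d)) = if d = 0 then (36, 0) else 0 := by
  decide

set_option maxRecDepth 10000 in
/-- Orthogonality along the columns of `coeff`. -/
lemma sum_mulConj_col : ∀ m d : Fin 6,
    ∑ p, mulConj (coeff p m) (coeff (p + d) m) = if d = 0 then (36, 0) else 0 := by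
  decide

set_option maxRecDepth 10000 in
/-- Orthogonality along the antidiagonals of `coeff`. -/
lemma sum_mulConj_antidiag : ∀ c d : Fin 6,
    ∑ p, mulConj (coeff p (c - p)) (coeff (p + d) (c - p + d)) =
      if d = 0 then (36, 0) else 0 := by
  decide

set_option maxRecDepth 10000 in
/-- Orthogonality along the diagonals of `coeff`. -/
lemma sum_mulConj_diag : ∀ c d : Fin 6,
    ∑ p, mulConj (coeff p (p + c)) (coeff (p + d) (p + c - d)) =
      if d = 0 then (36, 0) else 0 := by
  decide

lemma sum_mulConj_01 (i j i' j' : Fin 6) (h : i - j = i' - j') :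
    ∑ l, mulConj (coeff (i - j) (j - l))
      (coeff (i' - j') (j' - l)) =
      if i = i' ∧ j = j' then (36, 0) else 0 := by
  have hD : (i = i' ∧ j = j') ↔ j' - j = 0 := by grind
  simp only [hD]
  rw [← sum_mulConj_row (i - j) (j' - j)]
  refine Fintype.sum_equiv (Equiv.subLeft j) _ _ fun l => ?_
  simp only [Equiv.subLeft_apply]
  congr 2 <;> grind

lemma sum_amp_01 (i j i' j' : Fin 6) :
    ∑ k, ∑ l, amp i j k l * conj (amp i' j' k l) =
      if i = i' ∧ j = j' then (36 : ℂ)⁻¹ else 0 := by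
  refine sum_support (fun l => l + (i - j)) (fun l => l + (i' - j'))
    (fun l => coeff (i - j) (j - l)) (fun l => coeff (i' - j') (j' - l))
    (fun k l => amp i j k l) (fun k l => amp i' j' k l) ?_ ?_
    (i - j = i' - j') _ ?_ ?_ (sum_mulConj_01 i j i' j')
  · exact fun k l => amp_eq (by grind) fun _ => rfl
  · exact fun k l => amp_eq (by grind) fun _ => rfl
  · intro l
    simp
  · rintro ⟨rfl, rfl⟩
    rfl

lemma sum_mulConj_02 (i k i' k' : Fin 6) (h : i - k = i' - k') :
    ∑ l, mulConj (coeff (i - (l + (i - k))) ((l + (i - k)) - l))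
      (coeff (i' - (l + (i' - k'))) ((l + (i' - k')) - l)) =
      if i = i' ∧ k = k' then (36, 0) else 0 := by
  have hD : (i = i' ∧ k = k') ↔ k' - k = 0 := by grind
  simp only [hD]
  rw [← sum_mulConj_col (i - k) (k' - k)]
  refine Fintype.sum_equiv (Equiv.subLeft k) _ _ fun l => ?_
  simp only [Equiv.subLeft_apply]
  congr 2 <;> grind

lemma sum_amp_02 (i k i' k' : Fin 6) :
    ∑ j, ∑ l, amp i j k l * conj (amp i' j k' l) =
      if i = i' ∧ k = k' then (36 : ℂ)⁻¹ else 0 := by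
  refine sum_support (fun l => l + (i - k)) (fun l => l + (i' - k'))
    (fun l => coeff (i - (l + (i - k))) ((l + (i - k)) - l)) (fun l => coeff (i' - (l + (i' - k'))) ((l + (i' - k')) - l))
    (fun j l => amp i j k l) (fun j l => amp i' j k' l) ?_ ?_
    (i - k = i' - k') _ ?_ ?_ (sum_mulConj_02 i k i' k')
  · exact fun j l => amp_eq (by grind) fun h => by rw [h]
  · exact fun j l => amp_eq (by grind) fun h => by rw [h]
  · intro l
    simp
  · rintro ⟨rfl, rfl⟩
    rfl

lemma sum_mulConj_03 (i l i' l' : Fin 6) (h : i + l = i' + l') :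
    ∑ j, mulConj (coeff (i - j) (j - l))
      (coeff (i' - j) (j - l')) =
      if i = i' ∧ l = l' then (36, 0) else 0 := by
  have hD : (i = i' ∧ l = l') ↔ i' - i = 0 := by grind
  simp only [hD]
  rw [← sum_mulConj_antidiag (i - l) (i' - i)]
  refine Fintype.sum_equiv (Equiv.subLeft i) _ _ fun j => ?_
  simp only [Equiv.subLeft_apply]
  congr 2 <;> grind

lemma sum_amp_03 (i l i' l' : Fin 6) :
    ∑ k, ∑ j, amp i j k l * conj (amp i' j k l') =
      if i = i' ∧ l = l' then (36 : ℂ)⁻¹ else 0 := by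
  refine sum_support (fun j => i + l - j) (fun j => i' + l' - j)
    (fun j => coeff (i - j) (j - l)) (fun j => coeff (i' - j) (j - l'))
    (fun k j => amp i j k l) (fun k j => amp i' j k l') ?_ ?_
    (i + l = i' + l') _ ?_ ?_ (sum_mulConj_03 i l i' l')
  · exact fun k j => amp_eq (by grind) fun _ => rfl
  · exact fun k j => amp_eq (by grind) fun _ => rfl
  · intro j
    simp
  · rintro ⟨rfl, rfl⟩
    rfl

lemma sum_mulConj_12 (j k j' k' : Fin 6) (h : j + k = j' + k') :
    ∑ i, mulConj (coeff (i - j) (j - (j + k - i)))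
      (coeff (i - j') (j' - (j' + k' - i))) =
      if j = j' ∧ k = k' then (36, 0) else 0 := by
  have hD : (j = j' ∧ k = k') ↔ j - j' = 0 := by grind
  simp only [hD]
  rw [← sum_mulConj_diag (j - k) (j - j')]
  refine Fintype.sum_equiv (Equiv.subRight j) _ _ fun i => ?_
  simp only [Equiv.subRight_apply]
  congr 2 <;> grind

lemma sum_amp_12 (j k j' k' : Fin 6) :
    ∑ l, ∑ i, amp i j k l * conj (amp i j' k' l) =
      if j = j' ∧ k = k' then (36 : ℂ)⁻¹ else 0 := by
  refine sum_support (fun i => j + k - i) (fun i => j' + k' - i)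
    (fun i => coeff (i - j) (j - (j + k - i))) (fun i => coeff (i - j') (j' - (j' + k' - i)))
    (fun l i => amp i j k l) (fun l i => amp i j' k' l) ?_ ?_
    (j + k = j' + k') _ ?_ ?_ (sum_mulConj_12 j k j' k')
  · exact fun l i => amp_eq (by grind) fun h => by rw [h]
  · exact fun l i => amp_eq (by grind) fun h => by rw [h]
  · intro i
    simp
  · rintro ⟨rfl, rfl⟩
    rfl

lemma sum_mulConj_13 (j l j' l' : Fin 6) (h : l - j = l' - j') :
    ∑ i, mulConj (coeff (i - j) (j - l))
      (coeff (i - j') (j' - l')) =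
      if j = j' ∧ l = l' then (36, 0) else 0 := by
  have hD : (j = j' ∧ l = l') ↔ j - j' = 0 := by grind
  simp only [hD]
  rw [← sum_mulConj_col (j - l) (j - j')]
  refine Fintype.sum_equiv (Equiv.subRight j) _ _ fun i => ?_
  simp only [Equiv.subRight_apply]
  congr 2 <;> grind

lemma sum_amp_13 (j l j' l' : Fin 6) :
    ∑ k, ∑ i, amp i j k l * conj (amp i j' k l') =
      if j = j' ∧ l = l' then (36 : ℂ)⁻¹ else 0 := by
  refine sum_support (fun i => i + (l - j)) (fun i => i + (l' - j'))
    (fun i => coeff (i - j) (j - l)) (fun i => coeff (i - j') (j' - l'))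
    (fun k i => amp i j k l) (fun k i => amp i j' k l') ?_ ?_
    (l - j = l' - j') _ ?_ ?_ (sum_mulConj_13 j l j' l')
  · exact fun k i => amp_eq (by grind) fun _ => rfl
  · exact fun k i => amp_eq (by grind) fun _ => rfl
  · intro i
    simp
  · rintro ⟨rfl, rfl⟩
    rfl

lemma sum_mulConj_23 (k l k' l' : Fin 6) (h : k - l = k' - l') :
    ∑ j, mulConj (coeff ((j + (k - l)) - j) (j - l))
      (coeff ((j + (k' - l')) - j) (j - l')) =
      if k = k' ∧ l = l' then (36, 0) else 0 := by
  have hD : (k = k' ∧ l = l') ↔ l - l' = 0 := by grind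
  simp only [hD]
  rw [← sum_mulConj_row (k - l) (l - l')]
  refine Fintype.sum_equiv (Equiv.subRight l) _ _ fun j => ?_
  simp only [Equiv.subRight_apply]
  congr 2 <;> grind

lemma sum_amp_23 (k l k' l' : Fin 6) :
    ∑ i, ∑ j, amp i j k l * conj (amp i j k' l') =
      if k = k' ∧ l = l' then (36 : ℂ)⁻¹ else 0 := by
  refine sum_support (fun j => j + (k - l)) (fun j => j + (k' - l'))
    (fun j => coeff ((j + (k - l)) - j) (j - l)) (fun j => coeff ((j + (k' - l')) - j) (j - l'))
    (fun i j => amp i j k l) (fun i j => amp i j k' l') ?_ ?_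
    (k - l = k' - l') _ ?_ ?_ (sum_mulConj_23 k l k' l')
  · exact fun i j => amp_eq (by grind) fun h => by rw [h]
  · exact fun i j => amp_eq (by grind) fun h => by rw [h]
  · intro j
    simp
  · rintro ⟨rfl, rfl⟩
    rfl

/-- The state as a function on the computational basis. -/
noncomputable def state (x : Fin 4 → Fin 6) : ℂ := amp (x 0) (x 1) (x 2) (x 3)

lemma sum_fun_pair {ι : Type*} [DecidableEq ι] {T : Finset ι} {c d : ι} (hcd : c ≠ d)
    (hT : T = {c, d}) {M : Type*} [AddCommMonoid M] (F : ({i // i ∈ T} → Fin 6) → M) :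
    ∑ z, F z = ∑ k, ∑ l, F fun i => if i.1 = c then k else l := by
  subst hT
  rw [← Fintype.sum_prod_type' fun k l => F fun i => if i.1 = c then k else l]
  refine Fintype.sum_bijective
    (fun z => (z ⟨c, by simp⟩, z ⟨d, by simp⟩)) ⟨?_, ?_⟩ _ _ ?_
  · intro z w h
    funext ⟨i, hi⟩
    simp only [Prod.mk.injEq] at h
    rcases Finset.mem_insert.mp hi with rfl | hi'
    · exact h.1
    · obtain rfl := Finset.mem_singleton.mp hi'
      exact h.2
  · rintro ⟨k, l⟩
    exact ⟨fun i => if i.1 = c then k else l, by simp [hcd.symm]⟩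
  · intro z
    congr 1
    funext ⟨i, hi⟩
    rcases Finset.mem_insert.mp hi with rfl | hi'
    · simp
    · obtain rfl := Finset.mem_singleton.mp hi'
      simp [hcd.symm]

lemma fun_pair_eq_iff {ι : Type*} [DecidableEq ι] {a b : ι}
    (x y : {i // i ∈ ({a, b} : Finset ι)} → Fin 6) :
    x = y ↔ x ⟨a, by simp⟩ = y ⟨a, by simp⟩ ∧ x ⟨b, by simp⟩ = y ⟨b, by simp⟩ := by
  refine ⟨fun h => by simp [h], fun h => ?_⟩
  funext ⟨i, hi⟩
  rcases Finset.mem_insert.mp hi with rfl | hi'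
  · exact h.1
  · obtain rfl := Finset.mem_singleton.mp hi'
    exact h.2

lemma eq_pair_of_card_eq_two : ∀ S : Finset (Fin 4), S.card = 2 →
    S = {0, 1} ∨ S = {0, 2} ∨ S = {0, 3} ∨ S = {1, 2} ∨ S = {1, 3} ∨ S = {2, 3} := by
  decide

lemma rdm_pair {a b c d : Fin 4} (hcd : c ≠ d) (hc : ({a, b} : Finset (Fin 4))ᶜ = {c, d})
    (h : ∀ p q p' q' : Fin 6,
      ∑ s, ∑ t, state (fun i => if i = a then p else if i = b then q else if i = c then s else t) *
        conj (state (fun i => if i = a then p' else if i = b then q' else if i = c then s else t)) =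
      if p = p' ∧ q = q' then (36 : ℂ)⁻¹ else 0) :
    rdm {a, b} state = (36 : ℂ)⁻¹ • 1 := by
  have hglue : ∀ (x : {i // i ∈ ({a, b} : Finset (Fin 4))} → Fin 6) (s t : Fin 6),
      glue {a, b} x (fun i => if i.1 = c then s else t) =
        fun i => if i = a then x ⟨a, by simp⟩ else if i = b then x ⟨b, by simp⟩
          else if i = c then s else t := by
    intro x s t
    funext i
    by_cases hia : i = a
    · subst hia
      simp [glue]
    · by_cases hib : i = b
      · subst hib
        simp [glue, hia]
      · simp [glue, hia, hib]
  ext x y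
  rw [rdm, sum_fun_pair hcd hc]
  simp only [hglue, h, Matrix.smul_apply, Matrix.one_apply, fun_pair_eq_iff x y, smul_eq_mul,
    mul_ite, mul_one, mul_zero]

lemma rdm_state (S : Finset (Fin 4)) (hS : S.card = 2) : rdm S state = (36 : ℂ)⁻¹ • 1 := by
  rcases eq_pair_of_card_eq_two S hS with rfl | rfl | rfl | rfl | rfl | rfl
  · exact rdm_pair (c := 2) (d := 3) (by decide) (by decide) sum_amp_01
  · exact rdm_pair (c := 1) (d := 3) (by decide) (by decide) sum_amp_02
  · exact rdm_pair (c := 2) (d := 1) (by decide) (by decide) sum_amp_03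
  · exact rdm_pair (c := 3) (d := 0) (by decide) (by decide) sum_amp_12
  · exact rdm_pair (c := 2) (d := 0) (by decide) (by decide) sum_amp_13
  · exact rdm_pair (c := 0) (d := 1) (by decide) (by decide) sum_amp_23

lemma sum_fin_four {M : Type*} [AddCommMonoid M] (F : (Fin 4 → Fin 6) → M) :
    ∑ x, F x = ∑ i, ∑ j, ∑ k, ∑ l, F ![i, j, k, l] := by
  simp only [← Fintype.sum_prod_type']
  refine Fintype.sum_bijective (fun x : Fin 4 → Fin 6 => (x 0, x 1, x 2, x 3)) ⟨?_, ?_⟩ _ _ ?_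
  · intro x y h
    simp only [Prod.mk.injEq] at h
    funext i
    fin_cases i <;> simp [h]
  · rintro ⟨i, j, k, l⟩
    exact ⟨![i, j, k, l], rfl⟩
  · intro x
    congr 1
    funext i
    fin_cases i <;> rfl

lemma sum_normSq_state : ∑ x, Complex.normSq (state x) = 1 := by
  have h : ((∑ x, Complex.normSq (state x) : ℝ) : ℂ) = 1 := by
    push_cast
    rw [sum_fin_four]
    simp only [← Complex.mul_conj]
    have h' := fun i j => sum_amp_01 i j i j
    simp only [and_self, if_true] at h'
    simp [state, h']
    norm_num
  exact_mod_cast h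

end AME46

/-- There exists an AME(4,6) state: a normalized pure state of four
subsystems with six levels each all of whose two-party reduced density matrices are
maximally mixed, i.e. equal to (1/36)·Identity. -/
theorem ame46_exists :
    ∃ ψ : (Fin 4 → Fin 6) → ℂ,
      (∑ x, Complex.normSq (ψ x)) = 1 ∧
      ∀ S : Finset (Fin 4), S.card = 2 →
        rdm S ψ = ((36 : ℂ))⁻¹ •
          (1 : Matrix ({i // i ∈ S} → Fin 6) ({i // i ∈ S} → Fin 6) ℂ) := by
  exact ⟨AME46.state, AME46.sum_normSq_state, AME46.rdm_state⟩
end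

section
/- For every number of qubits N ≥ 3, the states ψ^N_m := (1/√(1+C(N,m)))·(√C(N,m)·|0…0⟩ − (−1)^{N+m}·|D^{N−m}_N⟩), where C(N,m) is the binomial coefficient and |D^{N−m}_N⟩ is the Dicke state of N qubits with N−m excitations, provide examples of m-resistant states for the three values m = 0, m = N−3 and m = N−2: the state ψ^N_0 is 0-resistant, the state ψ^N_{N−3} is (N−3)-resistant, and the state ψ^N_{N−2} is (N−2)-resistant. -/
open scoped ComplexConjugate

/-- Separability of a density matrix on parties `ι` with `d` levels each:
a finite convex combination of pure product states. -/
def IsSeparableMat {ι : Type} [Fintype ι] {d : ℕ}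
    (ρ : Matrix (ι → Fin d) (ι → Fin d) ℂ) : Prop :=
  ∃ (n : ℕ) (p : Fin n → ℝ) (φ : Fin n → ι → Fin d → ℂ),
    (∀ i, 0 ≤ p i) ∧ (∑ i, p i = 1) ∧
    (∀ i t, ∑ a, Complex.normSq (φ i t a) = 1) ∧
    ∀ x y, ρ x y = ∑ i, (p i : ℂ) * ∏ t, φ i t (x t) * conj (φ i t (y t))

/-- `ψ` is an `m`-resistant entangled state: `ψ` is entangled, tracing out any `m`
parties leaves an entangled state, and tracing out any `m+1` parties leaves a
separable state. -/
def MResistant {N d : ℕ} (m : ℕ) (ψ : (Fin N → Fin d) → ℂ) : Prop :=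
  ¬ IsSeparableMat (rdm (Finset.univ : Finset (Fin N)) ψ) ∧
  (∀ S : Finset (Fin N), S.card = m → ¬ IsSeparableMat (rdm Sᶜ ψ)) ∧
  (∀ S : Finset (Fin N), S.card = m + 1 → IsSeparableMat (rdm Sᶜ ψ))

/-- The Dicke state of `N` qubits with `j` excitations. -/
noncomputable def dicke (N j : ℕ) : (Fin N → Fin 2) → ℂ := fun x =>
  if (Finset.univ.filter (fun i => x i = 1)).card = j
  then ((Real.sqrt (N.choose j) : ℂ))⁻¹ else 0

/-- The state ψ^N_m = (1/√(1+C(N,m)))·(√C(N,m)·|0…0⟩ − (−1)^{N+m}·|D^{N−m}_N⟩). -/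
noncomputable def psiNm (N m : ℕ) : (Fin N → Fin 2) → ℂ := fun x =>
  ((Real.sqrt (1 + N.choose m) : ℂ))⁻¹ *
    ((Real.sqrt (N.choose m) : ℂ) * (if ∀ i, x i = 0 then 1 else 0)
      - (-1 : ℂ) ^ (N + m) * dicke N (N - m) x)

/-! ### Hamming weight of computational basis states -/

/-- The Hamming weight of a bit string. -/
def hammingWt {ι : Type} [Fintype ι] (x : ι → Fin 2) : ℕ :=
  (Finset.univ.filter (fun i => x i = 1)).card

section Weight

variable {ι : Type} [Fintype ι]

lemma hammingWt_le (x : ι → Fin 2) : hammingWt x ≤ Fintype.card ι :=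
  Finset.card_le_univ _

lemma hammingWt_eq_zero {x : ι → Fin 2} : hammingWt x = 0 ↔ ∀ i, x i = 0 := by
  simp only [hammingWt, Finset.card_eq_zero, Finset.filter_eq_empty_iff, Finset.mem_univ,
    true_implies]
  exact forall_congr' fun i => by omega

lemma hammingWt_eq_card {x : ι → Fin 2} : hammingWt x = Fintype.card ι ↔ ∀ i, x i = 1 := by
  simp [hammingWt, Finset.card_eq_iff_eq_univ, Finset.filter_eq_self]

lemma hammingWt_eq_sum (x : ι → Fin 2) : hammingWt x = ∑ i, if x i = 1 then 1 else 0 := by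
  simp [hammingWt]

lemma sum_hammingWt [DecidableEq ι] (F : ℕ → ℝ) :
    ∑ x : ι → Fin 2, F (hammingWt x)
      = ∑ r ∈ Finset.range (Fintype.card ι + 1), ((Fintype.card ι).choose r : ℝ) * F r := by
  have h := Finset.sum_powerset_apply_card F (x := (Finset.univ : Finset ι))
  simp only [nsmul_eq_mul, Finset.card_univ, Finset.powerset_univ] at h
  rw [← h]
  refine Finset.sum_bij' (fun x _ => Finset.univ.filter (fun i => x i = 1))
    (fun s _ i => if i ∈ s then 1 else 0) (by simp) (by simp) ?_ ?_ ?_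
  · intro x _
    funext i
    by_cases hi : x i = 1
    · simp [hi]
    · have : x i = 0 := by omega
      simp [this]
  · intro s _
    ext i
    simp
  · intro x _
    rfl

end Weight

lemma hammingWt_glue {N : ℕ} (T : Finset (Fin N)) (x : {i // i ∈ T} → Fin 2)
    (z : {i // i ∈ Tᶜ} → Fin 2) :
    hammingWt (glue T x z) = hammingWt x + hammingWt z := by
  simp only [hammingWt_eq_sum]
  rw [← Finset.sum_add_sum_compl T, ← Finset.sum_coe_sort T, ← Finset.sum_coe_sort Tᶜ]
  congr 1
  · refine Finset.sum_congr rfl fun i _ => ?_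
    simp [glue]
  · refine Finset.sum_congr rfl fun i _ => ?_
    have hi : (i : Fin N) ∉ T := Finset.mem_compl.mp i.2
    simp [glue, hi]

lemma sum_glue {N : ℕ} (T : Finset (Fin N)) (F : (Fin N → Fin 2) → ℝ) :
    ∑ x : {i // i ∈ T} → Fin 2, ∑ z : {i // i ∈ Tᶜ} → Fin 2, F (glue T x z) = ∑ w, F w := by
  rw [← Fintype.sum_prod_type']
  refine Finset.sum_bij' (fun p _ => glue T p.1 p.2)
    (fun w _ => (fun i => w i, fun i => w i)) (by simp) (by simp) ?_ ?_ (by simp)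
  · rintro ⟨x, z⟩ _
    refine Prod.ext ?_ ?_
    · funext i
      simp [glue]
    · funext i
      have hi : (i : Fin N) ∉ T := Finset.mem_compl.mp i.2
      simp [glue, hi]
  · intro w _
    funext i
    by_cases hi : i ∈ T <;> simp [glue, hi]

/-! ### Separability criteria -/

section Separability

variable {ι : Type} [Fintype ι]

lemma IsSeparableMat.of_fintype {d : ℕ} {κ : Type*} [Fintype κ]
    {ρ : Matrix (ι → Fin d) (ι → Fin d) ℂ} (p : κ → ℝ) (φ : κ → ι → Fin d → ℂ)
    (hp : ∀ i, 0 ≤ p i) (hsum : ∑ i, p i = 1)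
    (hφ : ∀ i t, ∑ a, Complex.normSq (φ i t a) = 1)
    (hρ : ∀ x y, ρ x y = ∑ i, (p i : ℂ) * ∏ t, φ i t (x t) * conj (φ i t (y t))) :
    IsSeparableMat ρ := by
  let e := (Fintype.equivFin κ).symm
  refine ⟨Fintype.card κ, p ∘ e, φ ∘ e, fun i => hp _, ?_, fun i t => hφ _ _, fun x y => ?_⟩
  · rw [← hsum]
    exact Equiv.sum_comp e p
  · rw [hρ]
    exact (Equiv.sum_comp e
      fun i => (p i : ℂ) * ∏ t, φ i t (x t) * conj (φ i t (y t))).symm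

lemma IsSeparableMat.of_diagonal [DecidableEq ι] {d : ℕ} {ρ : Matrix (ι → Fin d) (ι → Fin d) ℂ}
    (q : (ι → Fin d) → ℝ) (hq : ∀ x, 0 ≤ q x) (hsum : ∑ x, q x = 1)
    (hdiag : ∀ x, ρ x x = q x) (hoff : ∀ x y, x ≠ y → ρ x y = 0) : IsSeparableMat ρ := by
  refine .of_fintype q (fun w t a => if a = w t then 1 else 0) hq hsum ?_ ?_
  · intro w t
    simp [apply_ite Complex.normSq]
  · intro x y
    have key : ∀ w : ι → Fin d,
        ∏ t, (if x t = w t then (1 : ℂ) else 0) * conj (if y t = w t then (1 : ℂ) else 0)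
          = if x = w ∧ y = w then 1 else 0 := by
      intro w
      split_ifs with h
      · simp [h.1, h.2]
      · have : ∃ t, ¬ (x t = w t ∧ y t = w t) := by
          by_contra! hc
          exact h ⟨funext fun t => (hc t).1, funext fun t => (hc t).2⟩
        obtain ⟨t, ht⟩ := this
        refine Finset.prod_eq_zero (Finset.mem_univ t) ?_
        by_cases h1 : x t = w t
        · simp [show ¬ y t = w t from fun h2 => ht ⟨h1, h2⟩]
        · simp [h1]
    simp only [key]
    by_cases hxy : x = y
    · subst hxy
      simp [hdiag]
    · rw [hoff x y hxy, Finset.sum_eq_zero]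
      intro w _
      rw [if_neg (fun h => hxy (h.1.trans h.2.symm)), mul_zero]

/-- A weak form of the positive partial transpose criterion: in a separable state, a coherence
is bounded by the mean of the two populations obtained by exchanging some of the local indices. -/
lemma IsSeparableMat.two_mul_norm_le {d : ℕ} {ρ : Matrix (ι → Fin d) (ι → Fin d) ℂ}
    (h : IsSeparableMat ρ) (x y x' y' : ι → Fin d)
    (hswap : ∀ t, (x' t = x t ∧ y' t = y t) ∨ (x' t = y t ∧ y' t = x t)) :
    2 * ‖ρ x y‖ ≤ (ρ x' x').re + (ρ y' y').re := by
  obtain ⟨n, p, φ, hp, -, -, hρ⟩ := h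
  have hdiag : ∀ w, (ρ w w).re = ∑ i, p i * (∏ t, ‖φ i t (w t)‖) ^ 2 := by
    intro w
    rw [hρ, Complex.re_sum]
    refine Finset.sum_congr rfl fun i _ => ?_
    have : ∏ t, φ i t (w t) * conj (φ i t (w t))
        = (((∏ t, ‖φ i t (w t)‖) ^ 2 : ℝ) : ℂ) := by
      rw [← Finset.prod_pow]
      push_cast
      exact Finset.prod_congr rfl fun t _ => Complex.mul_conj' _
    rw [this, ← Complex.ofReal_mul, Complex.ofReal_re]
  rw [hdiag, hdiag, ← Finset.sum_add_distrib, hρ]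
  refine (mul_le_mul_of_nonneg_left (norm_sum_le _ _) zero_le_two).trans ?_
  rw [Finset.mul_sum]
  refine Finset.sum_le_sum fun i _ => ?_
  have hprod : ∏ t, ‖φ i t (x t) * conj (φ i t (y t))‖
      = (∏ t, ‖φ i t (x' t)‖) * ∏ t, ‖φ i t (y' t)‖ := by
    rw [← Finset.prod_mul_distrib]
    refine Finset.prod_congr rfl fun t _ => ?_
    rw [norm_mul, RCLike.norm_conj]
    rcases hswap t with ⟨h1, h2⟩ | ⟨h1, h2⟩ <;> rw [h1, h2]
    exact mul_comm _ _
  rw [norm_mul, norm_prod, hprod, Complex.norm_real, Real.norm_of_nonneg (hp i)]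
  nlinarith [mul_nonneg (hp i) (sq_nonneg ((∏ t, ‖φ i t (x' t)‖) - ∏ t, ‖φ i t (y' t)‖))]

/-- A two-qubit permutation-invariant state without coherences between different weights is
separable as soon as its partial transpose is positive. -/
lemma IsSeparableMat.of_two_qubits (hι : Fintype.card ι = 2)
    {ρ : Matrix (ι → Fin 2) (ι → Fin 2) ℂ} {A B D : ℝ} (hB : 0 ≤ B) (hD : 0 < D)
    (htr : A + 2 * B + D = 1) (hppt : B ^ 2 ≤ A * D)
    (hρ : ∀ x y, ρ x y = if hammingWt x = hammingWt y then
      (if hammingWt x = 0 then (A : ℂ) else if hammingWt x = 1 then (B : ℂ) else (D : ℂ))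
      else 0) : IsSeparableMat ρ := by
  classical
  have hBD : 0 < B + D := by positivity
  set α : ℝ := √(B / (B + D)) with hα
  set β : ℝ := √(D / (B + D)) with hβ
  have hα2 : α ^ 2 = B / (B + D) := Real.sq_sqrt (by positivity)
  have hβ2 : β ^ 2 = D / (B + D) := Real.sq_sqrt (by positivity)
  set p : ℝ := (B + D) ^ 2 / (4 * D) with hp
  have hA' : 4 * p * α ^ 4 + (1 - 4 * p) = A := by
    rw [show α ^ 4 = (α ^ 2) ^ 2 by ring, hα2, hp, show A = 1 - 2 * B - D by linarith]
    field_simp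
    ring
  have hB' : 4 * p * (α ^ 2 * β ^ 2) = B := by
    rw [hα2, hβ2, hp]
    field_simp
  have hD' : 4 * p * β ^ 4 = D := by
    rw [show β ^ 4 = (β ^ 2) ^ 2 by ring, hβ2, hp]
    field_simp
  refine .of_fintype (κ := Option (Fin 4)) (fun o => o.elim (1 - 4 * p) fun _ => p)
    (fun o _ a => o.elim (if a = 0 then 1 else 0)
      fun j => if a = 0 then (α : ℂ) else Complex.I ^ (j : ℕ) * β) ?_ ?_ ?_ ?_
  · rintro (_ | j)
    · have : 4 * p ≤ 1 := by
        rw [hp, show (4 : ℝ) * ((B + D) ^ 2 / (4 * D)) = (B + D) ^ 2 / D by field_simp,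
          div_le_one hD]
        nlinarith
      simpa using this
    · simp only [Option.elim]
      positivity
  · simp [Fintype.sum_option]
  · rintro (_ | j) t
    · simp
    · have : α * α + β * β = 1 := by
        rw [← sq, ← sq, hα2, hβ2]
        field_simp
      simpa using this
  · intro x y
    obtain ⟨a, b, hab, huniv⟩ := Finset.card_eq_two.mp ((Finset.card_univ (α := ι)).trans hι)
    rw [hρ]
    simp only [hammingWt_eq_sum, huniv, Finset.sum_pair hab, Finset.prod_pair hab,
      Fintype.sum_option, Fin.sum_univ_four, Option.elim]
    have hAc : (4 * p * α ^ 4 + (1 - 4 * p) : ℂ) = A := by exact_mod_cast hA'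
    have hBc : (4 * p * (α ^ 2 * β ^ 2) : ℂ) = B := by exact_mod_cast hB'
    have hDc : (4 * p * β ^ 4 : ℂ) = D := by exact_mod_cast hD'
    have hI : Complex.I ^ 2 = -1 := Complex.I_sq
    have hI3 : Complex.I ^ 3 = -Complex.I := Complex.I_pow_three
    rw [← hAc, ← hBc, ← hDc]
    clear_value α β p
    clear hρ hppt htr hA' hB' hD' hAc hBc hDc hα2 hβ2 hα hβ hp
    rcases Fin.exists_fin_two.mp ⟨x a, rfl⟩ with h1 | h1 <;>
    rcases Fin.exists_fin_two.mp ⟨x b, rfl⟩ with h2 | h2 <;>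
    rcases Fin.exists_fin_two.mp ⟨y a, rfl⟩ with h3 | h3 <;>
    rcases Fin.exists_fin_two.mp ⟨y b, rfl⟩ with h4 | h4 <;>
    simp [h1, h2, h3, h4, hI3] <;> grind

end Separability

/-! ### The states `psiNm` -/

/-- The amplitude of `psiNm N (N - k)` on basis states of weight `r`. -/
noncomputable def psiAmp (N k r : ℕ) : ℝ :=
  (√(1 + N.choose k))⁻¹ *
    (√(N.choose k) * (if r = 0 then 1 else 0)
      - (-1) ^ k * (if r = k then (√(N.choose k))⁻¹ else 0))

lemma psiNm_eq {N m : ℕ} (hm : m ≤ N) (x : Fin N → Fin 2) :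
    psiNm N m x = psiAmp N (N - m) (hammingWt x) := by
  have hsign : (-1 : ℂ) ^ (N + m) = (-1) ^ (N - m) := by
    rw [show N + m = N - m + 2 * m by omega, pow_add, pow_mul]
    simp
  have hdicke : dicke N (N - m) x
      = if hammingWt x = N - m then ((√(N.choose (N - m)) : ℂ))⁻¹ else 0 := rfl
  simp only [psiNm, psiAmp, hdicke, Nat.choose_symm hm, hsign, ← hammingWt_eq_zero]
  push_cast [apply_ite Complex.ofReal]
  rfl

section Amplitude

variable {N k : ℕ}

lemma psiAmp_zero_sq (hk : 0 < k) :
    psiAmp N k 0 ^ 2 = N.choose k / (1 + N.choose k) := by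
  have h1 : (0 : ℝ) ≤ 1 + N.choose k := by positivity
  simp only [psiAmp, if_true, if_neg hk.ne, mul_one, mul_zero, sub_zero]
  rw [mul_pow, inv_pow, Real.sq_sqrt h1, Real.sq_sqrt (Nat.cast_nonneg _)]
  ring

lemma psiAmp_self_sq (hk : 0 < k) :
    psiAmp N k k ^ 2 = 1 / (N.choose k * (1 + N.choose k)) := by
  have h1 : (0 : ℝ) ≤ 1 + N.choose k := by positivity
  simp only [psiAmp, if_true, if_neg hk.ne', mul_zero, zero_sub]
  rw [mul_pow, neg_sq, mul_pow, ← pow_mul, mul_comm k 2, pow_mul, neg_one_sq, one_pow, one_mul,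
    inv_pow, inv_pow, Real.sq_sqrt h1, Real.sq_sqrt (Nat.cast_nonneg _)]
  rw [one_div, mul_inv, mul_comm]

lemma psiAmp_eq_zero {r : ℕ} (h0 : r ≠ 0) (hk : r ≠ k) : psiAmp N k r = 0 := by
  simp [psiAmp, h0, hk]

lemma sum_psiAmp_sq (hk : 0 < k) (hkN : k ≤ N) :
    ∑ w : Fin N → Fin 2, psiAmp N k (hammingWt w) ^ 2 = 1 := by
  have hc : (0 : ℝ) < N.choose k := by exact_mod_cast Nat.choose_pos hkN
  rw [sum_hammingWt fun r => psiAmp N k r ^ 2, Fintype.card_fin,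
    Finset.sum_eq_add_of_mem 0 k (by simp) (by simp; omega) hk.ne]
  · rw [psiAmp_zero_sq hk, psiAmp_self_sq hk]
    simp
    field_simp
    ring
  · rintro r - ⟨h0, h1⟩
    simp [psiAmp_eq_zero h0 h1]

/-- Entries of the reduced density matrix in terms of amplitudes. -/
noncomputable def psiEntry (N k n i j : ℕ) : ℝ :=
  ∑ r ∈ Finset.range (n + 1), (n.choose r : ℝ) * (psiAmp N k (i + r) * psiAmp N k (j + r))

lemma psiEntry_eq_sum {T : Finset (Fin N)} (i j : ℕ) :
    psiEntry N k (N - T.card) i j = ∑ z : {i // i ∈ Tᶜ} → Fin 2,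
      psiAmp N k (i + hammingWt z) * psiAmp N k (j + hammingWt z) := by
  rw [sum_hammingWt fun r => psiAmp N k (i + r) * psiAmp N k (j + r)]
  simp [psiEntry]

lemma rdm_psiNm (hkN : k ≤ N) (T : Finset (Fin N)) (x y : {i // i ∈ T} → Fin 2) :
    rdm T (psiNm N (N - k)) x y
      = psiEntry N k (N - T.card) (hammingWt x) (hammingWt y) := by
  rw [psiEntry_eq_sum, rdm]
  push_cast
  refine Finset.sum_congr rfl fun z _ => ?_
  rw [psiNm_eq (Nat.sub_le _ _), psiNm_eq (Nat.sub_le _ _), hammingWt_glue, hammingWt_glue,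
    Complex.conj_ofReal, Nat.sub_sub_self hkN]

lemma psiEntry_self_nonneg (n i : ℕ) : 0 ≤ psiEntry N k n i i :=
  Finset.sum_nonneg fun _ _ => mul_nonneg (Nat.cast_nonneg _) (mul_self_nonneg _)

lemma psiAmp_zero_sq_le_psiEntry (n : ℕ) : psiAmp N k 0 ^ 2 ≤ psiEntry N k n 0 0 := by
  refine le_trans ?_ (Finset.single_le_sum
    (f := fun r => (n.choose r : ℝ) * (psiAmp N k (0 + r) * psiAmp N k (0 + r)))
    (fun r _ => mul_nonneg (Nat.cast_nonneg _) (mul_self_nonneg _))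
    (Finset.mem_range.mpr n.succ_pos))
  simp [sq]

lemma sum_psiEntry (hk : 0 < k) (hkN : k ≤ N) (T : Finset (Fin N)) :
    ∑ x : {i // i ∈ T} → Fin 2, psiEntry N k (N - T.card) (hammingWt x) (hammingWt x) = 1 := by
  rw [← sum_psiAmp_sq hk hkN, ← sum_glue T]
  simp only [psiEntry_eq_sum, hammingWt_glue, sq]

lemma psiEntry_zero_self (hk : 0 < k) (n : ℕ) :
    psiEntry N k n 0 k = psiAmp N k 0 * psiAmp N k k := by
  rw [psiEntry, Finset.sum_eq_single 0]
  · simp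
  · intro r _ hr
    rw [psiAmp_eq_zero (r := k + r) (by omega) (by omega)]
    simp
  · simp

lemma psiEntry_diag {i j : ℕ} (hi : 0 < i) (hij : i + j = k) (n : ℕ) :
    psiEntry N k n i i = n.choose j * psiAmp N k k ^ 2 := by
  rw [psiEntry, Finset.sum_eq_single j]
  · rw [hij, sq]
  · intro r _ hr
    rw [psiAmp_eq_zero (r := i + r) (by omega) (by omega)]
    simp
  · intro hj
    rw [Nat.choose_eq_zero_of_lt (by simpa using hj)]
    simp

lemma psiEntry_eq_zero {i j : ℕ} (hi : i < k) (hj : j < k) (hij : i ≠ j) (n : ℕ) :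
    psiEntry N k n i j = 0 := by
  refine Finset.sum_eq_zero fun r _ => ?_
  by_cases h1 : i + r = 0 ∨ i + r = k
  · rw [psiAmp_eq_zero (r := j + r) (by omega) (by omega)]
    simp
  · rw [psiAmp_eq_zero (r := i + r) (by omega) (by omega)]
    simp

end Amplitude

/-- The reduction of `psiNm N (N - k)` to at least `k` parties is entangled. -/
lemma not_isSeparableMat_rdm_psiNm {N k : ℕ} (hk : 2 ≤ k) (hkN : k ≤ N) (T : Finset (Fin N))
    (hT : k ≤ T.card) : ¬ IsSeparableMat (rdm T (psiNm N (N - k))) := by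
  classical
  intro hsep
  have hk0 : 0 < k := by omega
  obtain ⟨K, -, hK⟩ := Finset.exists_subset_card_eq (s := (Finset.univ : Finset {i // i ∈ T}))
    (n := k) (by simpa using hT)
  obtain ⟨a, ha, b, hb, hab⟩ := Finset.one_lt_card.mp (hK ▸ hk : 1 < K.card)
  let y : {i // i ∈ T} → Fin 2 := fun t => if t ∈ K then 1 else 0
  let x' : {i // i ∈ T} → Fin 2 := fun t => if t = a then 1 else 0
  let y' : {i // i ∈ T} → Fin 2 := fun t => if t ∈ K ∧ t ≠ a then 1 else 0
  have hwty : hammingWt y = k := by simp [hammingWt, y, hK, -Finset.univ_eq_attach]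
  have hwt0 : hammingWt (0 : {i // i ∈ T} → Fin 2) = 0 := hammingWt_eq_zero.mpr fun _ => rfl
  have hmain := hsep.two_mul_norm_le 0 y x' y' fun t => by
    by_cases hta : t = a
    · subst hta
      simp [x', y', y, ha]
    · simp [x', y', y, hta]
  simp only [rdm_psiNm hkN, hwt0, hwty, Complex.ofReal_re, Complex.norm_real,
    psiEntry_zero_self hk0] at hmain
  have hx0 : (0 : {i // i ∈ T} → Fin 2) ≠ x' := fun h => by simpa [x'] using congrFun h a
  have hy0 : (0 : {i // i ∈ T} → Fin 2) ≠ y' := fun h => by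
    simpa [y', hb, hab.symm] using congrFun h b
  have hxy : x' ≠ y' := fun h => by simpa [x', y'] using congrFun h a
  have htr : psiEntry N k (N - T.card) 0 0
      + (psiEntry N k (N - T.card) (hammingWt x') (hammingWt x')
      + psiEntry N k (N - T.card) (hammingWt y') (hammingWt y')) ≤ 1 := by
    rw [← sum_psiEntry hk0 hkN T]
    refine le_trans (le_of_eq ?_) (Finset.sum_le_sum_of_subset_of_nonneg
      (Finset.subset_univ {0, x', y'}) fun _ _ _ => psiEntry_self_nonneg _ _)
    rw [Finset.sum_insert (by simp [hx0, hy0]), Finset.sum_pair hxy, hwt0]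
  have h00 := psiAmp_zero_sq_le_psiEntry (N := N) (k := k) (N - T.card)
  have hc : (0 : ℝ) < N.choose k := by exact_mod_cast Nat.choose_pos hkN
  have hnorm : ‖psiAmp N k 0 * psiAmp N k k‖ = 1 / (1 + N.choose k) := by
    rw [Real.norm_eq_abs, ← Real.sqrt_sq_eq_abs, mul_pow, psiAmp_zero_sq hk0, psiAmp_self_sq hk0,
      Real.sqrt_eq_iff_mul_self_eq (by positivity) (by positivity)]
    field_simp
  rw [psiAmp_zero_sq hk0] at h00
  rw [hnorm] at hmain
  have h1 : (N.choose k : ℝ) / (1 + N.choose k) = 1 - 1 / (1 + N.choose k) := by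
    field_simp
    ring
  have h2 : (0 : ℝ) < 1 / (1 + N.choose k) := by positivity
  linarith

lemma isSeparableMat_rdm_psiNm_of_diagonal {N k : ℕ} (hkN : k ≤ N) (T : Finset (Fin N))
    (hTk : T.card < k) (hT : T.card = 1 ∨ (T.card + 1 = N ∧ k = N)) :
    IsSeparableMat (rdm T (psiNm N (N - k))) := by
  have hk0 : 0 < k := by omega
  refine .of_diagonal (fun x => psiEntry N k (N - T.card) (hammingWt x) (hammingWt x))
    (fun x => psiEntry_self_nonneg _ _) (sum_psiEntry hk0 hkN T)
    (fun x => rdm_psiNm hkN T x x) fun x y hxy => ?_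
  rw [rdm_psiNm hkN]
  have hcard : Fintype.card {i // i ∈ T} = T.card := Fintype.card_coe T
  have hx := hammingWt_le x
  have hy := hammingWt_le y
  rw [hcard] at hx hy
  by_cases hw : hammingWt x = hammingWt y
  · have h0 : hammingWt x ≠ 0 := fun h => hxy <| funext fun t => by
      rw [hammingWt_eq_zero.mp h t, hammingWt_eq_zero.mp (hw.symm.trans h) t]
    have h1 : hammingWt x ≠ T.card := fun h => hxy <| funext fun t => by
      rw [hammingWt_eq_card.mp (h.trans hcard.symm) t,
        hammingWt_eq_card.mp ((hw.symm.trans h).trans hcard.symm) t]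
    rw [← hw, psiEntry_diag (j := k - hammingWt x) (by omega) (by omega),
      Nat.choose_eq_zero_of_lt (by omega)]
    simp
  · rw [psiEntry_eq_zero (by omega) (by omega) hw, Complex.ofReal_zero]

lemma isSeparableMat_rdm_psiNm_three {N : ℕ} (hN : 3 ≤ N) (T : Finset (Fin N))
    (hT : T.card = 2) : IsSeparableMat (rdm T (psiNm N (N - 3))) := by
  have hcard : Fintype.card {i // i ∈ T} = 2 := (Fintype.card_coe T).trans hT
  have hc : (0 : ℝ) < N.choose 3 := by exact_mod_cast Nat.choose_pos hN
  have hs : (0 : ℝ) < psiAmp N 3 3 ^ 2 := by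
    rw [psiAmp_self_sq (by norm_num)]
    positivity
  have hN2 : (1 : ℝ) ≤ ((N - 2 : ℕ) : ℝ) := by exact_mod_cast (by omega : 1 ≤ N - 2)
  have hB : psiEntry N 3 (N - 2) 1 1 = (N - 2).choose 2 * psiAmp N 3 3 ^ 2 :=
    psiEntry_diag (by norm_num) (by norm_num) _
  have hD : psiEntry N 3 (N - 2) 2 2 = (N - 2 : ℕ) * psiAmp N 3 3 ^ 2 := by
    rw [psiEntry_diag (j := 1) (by norm_num) (by norm_num), Nat.choose_one_right]
  refine .of_two_qubits hcard (psiEntry_self_nonneg (N := N) (k := 3) (N - 2) 1)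
    (D := psiEntry N 3 (N - 2) 2 2) ?_ (A := psiEntry N 3 (N - 2) 0 0) ?_ ?_ fun x y => ?_
  · rw [hD]
    positivity
  · have h := sum_psiEntry (by norm_num) hN T
    rw [sum_hammingWt fun r => psiEntry N 3 (N - T.card) r r, hcard, hT] at h
    simpa [Finset.sum_range_succ] using h
  · have hA : (N.choose 3 : ℝ) ^ 2 * psiAmp N 3 3 ^ 2 ≤ psiEntry N 3 (N - 2) 0 0 := by
      refine le_trans (le_of_eq ?_) (psiAmp_zero_sq_le_psiEntry _)
      rw [psiAmp_zero_sq (by norm_num), psiAmp_self_sq (by norm_num)]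
      field_simp
    have hchoose : ((N - 2).choose 2 : ℝ) ≤ N.choose 3 := by
      obtain ⟨n, rfl⟩ : ∃ n, N = n + 1 := ⟨N - 1, by omega⟩
      have h1 : (n + 1 - 2).choose 2 ≤ n.choose 2 := Nat.choose_le_choose 2 (by omega)
      have h2 : (n + 1).choose 3 = n.choose 2 + n.choose 3 := Nat.choose_succ_succ' n 2
      exact_mod_cast (by omega : (n + 1 - 2).choose 2 ≤ (n + 1).choose 3)
    calc psiEntry N 3 (N - 2) 1 1 ^ 2
        = ((N - 2).choose 2 : ℝ) ^ 2 * (psiAmp N 3 3 ^ 2) ^ 2 := by rw [hB]; ring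
      _ ≤ (N.choose 3 : ℝ) ^ 2 * (psiAmp N 3 3 ^ 2) ^ 2 := by gcongr
      _ = (N.choose 3 : ℝ) ^ 2 * psiAmp N 3 3 ^ 2 * (1 * psiAmp N 3 3 ^ 2) := by ring
      _ ≤ psiEntry N 3 (N - 2) 0 0 * psiEntry N 3 (N - 2) 2 2 := by
        rw [hD]
        gcongr
        exact psiEntry_self_nonneg _ _
  · rw [rdm_psiNm hN, hT]
    have hx := hammingWt_le x
    have hy := hammingWt_le y
    rw [hcard] at hx hy
    split_ifs with h h0 h1
    · rw [← h, h0]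
    · rw [← h, h1]
    · rw [← h, show hammingWt x = 2 by omega]
    · rw [psiEntry_eq_zero (by omega) (by omega) h, Complex.ofReal_zero]

lemma mResistant_psiNm {N k : ℕ} (hk : 2 ≤ k) (hkN : k ≤ N)
    (hsep : ∀ T : Finset (Fin N), T.card + 1 = k → IsSeparableMat (rdm T (psiNm N (N - k)))) :
    MResistant (N - k) (psiNm N (N - k)) := by
  refine ⟨not_isSeparableMat_rdm_psiNm hk hkN _ (by simpa using hkN), fun S hS => ?_,
    fun S hS => hsep _ ?_⟩
  · refine not_isSeparableMat_rdm_psiNm hk hkN _ ?_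
    rw [Finset.card_compl, Fintype.card_fin]
    omega
  · rw [Finset.card_compl, Fintype.card_fin]
    omega

/-- For every `N ≥ 3`, the state ψ^N_0 is 0-resistant, ψ^N_{N−3} is
(N−3)-resistant, and ψ^N_{N−2} is (N−2)-resistant. -/
theorem psiNm_resistant (N : ℕ) (hN : 3 ≤ N) :
    MResistant 0 (psiNm N 0) ∧
    MResistant (N - 3) (psiNm N (N - 3)) ∧
    MResistant (N - 2) (psiNm N (N - 2)) := by
  refine ⟨?_, ?_, ?_⟩
  · have h := mResistant_psiNm (N := N) (by omega) le_rfl fun T hT =>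
      isSeparableMat_rdm_psiNm_of_diagonal le_rfl T (by omega) (Or.inr ⟨hT, rfl⟩)
    rwa [Nat.sub_self] at h
  · exact mResistant_psiNm (by norm_num) hN fun T hT =>
      isSeparableMat_rdm_psiNm_three hN T (by omega)
  · exact mResistant_psiNm le_rfl (by omega) fun T hT =>
      isSeparableMat_rdm_psiNm_of_diagonal (by omega) T (by omega) (Or.inl (by omega))
end

section
/- Let d ≥ 2, k ≥ 1 and N ≥ 2k, and let A be an orthogonal array OA(d^k, N, d, k) of index unity. Then the quantum state ψ_A of N qudits with d levels associated with A is (k−1)-resistant. -/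
open scoped ComplexConjugate

/-- `A` is an orthogonal array OA(r,N,d,k) of index unity (r = d^k): for every set `C`
of `k` columns and every assignment `u : C → Fin d`, exactly one row agrees with `u`
on `C`. -/
def IsOAIndexUnity {N d k : ℕ} (A : Fin (d ^ k) → (Fin N → Fin d)) : Prop :=
  ∀ C : Finset (Fin N), C.card = k → ∀ u : {i // i ∈ C} → Fin d,
    (Finset.univ.filter (fun a => ∀ i : {i // i ∈ C}, A a i.1 = u i)).card = 1

/-- The quantum state associated with an orthogonal array:
ψ_A(x) = (number of rows of A equal to x)/√r. -/
noncomputable def oaState {r N d : ℕ} (A : Fin r → (Fin N → Fin d)) :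
    (Fin N → Fin d) → ℂ := fun x =>
  ((Finset.univ.filter (fun a => A a = x)).card : ℂ) / (Real.sqrt r : ℂ)

theorem eq_glue_iff {N d : ℕ} (T : Finset (Fin N)) (f : Fin N → Fin d)
    (x : {i // i ∈ T} → Fin d) (z : {i // i ∈ Tᶜ} → Fin d) :
    f = glue T x z ↔ (∀ i : {i // i ∈ T}, f i = x i) ∧ (fun i : {i // i ∈ Tᶜ} => f i) = z := by
  constructor
  · rintro rfl
    refine ⟨fun i => by simp [glue], ?_⟩
    funext i
    simp [glue, Finset.mem_compl.mp i.2]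
  · rintro ⟨hx, rfl⟩
    funext i
    by_cases h : i ∈ T
    · simp [glue, h, ← hx ⟨i, h⟩]
    · simp [glue, h]

/-- In a separable matrix, an off-diagonal entry at `(x, y)` vanishes as soon as the diagonal entry
at some mixture `w` of `x` and `y` does. -/
theorem IsSeparableMat.eq_zero_of_diag_eq_zero {ι : Type} [Fintype ι] {d : ℕ}
    {ρ : Matrix (ι → Fin d) (ι → Fin d) ℂ} (hρ : IsSeparableMat ρ) {x y w : ι → Fin d}
    (hw : ∀ t, w t = x t ∨ w t = y t) (h0 : ρ w w = 0) : ρ x y = 0 := by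
  obtain ⟨n, p, φ, hp, -, -, hρ⟩ := hρ
  have hsum : ∑ i, p i * ∏ t, Complex.normSq (φ i t (w t)) = 0 := by
    have h := (hρ w w).symm.trans h0
    simp only [Complex.mul_conj] at h
    exact_mod_cast h
  have hterm := (Finset.sum_eq_zero_iff_of_nonneg fun i _ =>
    mul_nonneg (hp i) (Finset.prod_nonneg fun t _ => Complex.normSq_nonneg _)).mp hsum
  rw [hρ]
  refine Finset.sum_eq_zero fun i hi => ?_
  rcases mul_eq_zero.mp (hterm i hi) with h | h
  · simp [h]
  · obtain ⟨t, ht, h⟩ := Finset.prod_eq_zero_iff.mp h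
    have h := Complex.normSq_eq_zero.mp h
    rw [Finset.prod_eq_zero ht, mul_zero]
    rcases hw t with hwt | hwt <;> simp [← hwt, h]

/-- Two rows of an orthogonal array of index unity agreeing on at least `k` columns coincide. -/
theorem IsOAIndexUnity.eq_of_agree {N d k : ℕ} {A : Fin (d ^ k) → (Fin N → Fin d)}
    (hA : IsOAIndexUnity A) {C : Finset (Fin N)} (hC : k ≤ C.card) {a b : Fin (d ^ k)}
    (h : ∀ i ∈ C, A a i = A b i) : a = b := by
  obtain ⟨C', hC', hcard⟩ := Finset.exists_subset_card_eq hC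
  have h1 := hA C' hcard fun i => A b i
  exact Finset.card_le_one.mp h1.le a (by simpa using fun i hi => h i (hC' hi)) b (by simp)

/-- Every pattern on `k` columns is realised by a row. -/
theorem IsOAIndexUnity.exists_row {N d k : ℕ} {A : Fin (d ^ k) → (Fin N → Fin d)}
    (hA : IsOAIndexUnity A) {C : Finset (Fin N)} (hC : C.card = k) (u : Fin N → Fin d) :
    ∃ a, ∀ i ∈ C, A a i = u i := by
  have h1 := hA C hC fun i => u i
  obtain ⟨a, ha⟩ := Finset.card_pos.mp (h1 ▸ Nat.one_pos)
  exact ⟨a, by simpa using ha⟩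

/-- The reduced density matrix of an array state, as a sum over pairs of rows. -/
theorem rdm_oaState {r N d : ℕ} (A : Fin r → (Fin N → Fin d)) (T : Finset (Fin N))
    (x y : {i // i ∈ T} → Fin d) :
    rdm T (oaState A) x y = ((r : ℝ)⁻¹ * ∑ a, ∑ b, if (∀ i : {i // i ∈ T}, A a i = x i) ∧
      (∀ i : {i // i ∈ T}, A b i = y i) ∧ ∀ i ∈ Tᶜ, A a i = A b i then (1 : ℝ) else 0 : ℝ) := by
  have hs : ((Real.sqrt r : ℂ))⁻¹ * (Real.sqrt r : ℂ)⁻¹ = (r : ℂ)⁻¹ := by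
    rw [← mul_inv, ← Complex.ofReal_mul, Real.mul_self_sqrt (Nat.cast_nonneg r),
      Complex.ofReal_natCast]
  have hψ (v : Fin N → Fin d) :
      oaState A v = (∑ a, if A a = v then (1 : ℂ) else 0) * (Real.sqrt r : ℂ)⁻¹ := by
    simp [oaState, div_eq_mul_inv]
  have hterm (a b : Fin r) :
      (∑ z, (if A a = glue T x z then (1 : ℂ) else 0) * if A b = glue T y z then 1 else 0) =
      if (∀ i : {i // i ∈ T}, A a i = x i) ∧ (∀ i : {i // i ∈ T}, A b i = y i) ∧
        ∀ i ∈ Tᶜ, A a i = A b i then 1 else 0 := by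
    have hagree : (∀ i ∈ Tᶜ, A a i = A b i) ↔
        (fun i : {i // i ∈ Tᶜ} => A b i) = fun i : {i // i ∈ Tᶜ} => A a i := by
      simp only [funext_iff, Subtype.forall, eq_comm]
    rw [Finset.sum_eq_single fun i : {i // i ∈ Tᶜ} => A a i]
    · simp only [eq_glue_iff, hagree, and_true, ← ite_and, mul_ite, mul_one, mul_zero]
      congr 1
      exact propext (by tauto)
    · intro z _ hz
      rw [if_neg, zero_mul]
      exact fun h => hz ((eq_glue_iff _ _ _ _).mp h).2.symm
    · simp
  calc rdm T (oaState A) x y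
      = ∑ z, (r : ℂ)⁻¹ * ∑ a, ∑ b, (if A a = glue T x z then (1 : ℂ) else 0) *
          if A b = glue T y z then 1 else 0 := by
        refine Finset.sum_congr rfl fun z _ => ?_
        rw [hψ, hψ, ← Finset.sum_mul_sum, ← hs]
        simp only [map_mul, map_sum, map_inv₀, Complex.conj_ofReal, apply_ite conj, map_one,
          map_zero]
        ring
    _ = (r : ℂ)⁻¹ * ∑ a, ∑ b, ∑ z, (if A a = glue T x z then (1 : ℂ) else 0) *
          if A b = glue T y z then 1 else 0 := by
        rw [← Finset.mul_sum, Finset.sum_comm]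
        congr 1
        exact Finset.sum_congr rfl fun a _ => Finset.sum_comm
    _ = _ := by
        simp only [hterm, Complex.ofReal_mul, Complex.ofReal_inv, Complex.ofReal_natCast,
          Complex.ofReal_sum, apply_ite Complex.ofReal, Complex.ofReal_one, Complex.ofReal_zero]

/-- The reduced state on more than `k` parties, with fewer than `k` parties traced out,
is entangled. -/
theorem IsOAIndexUnity.not_isSeparableMat_rdm {N d k : ℕ} (hd : 2 ≤ d)
    {A : Fin (d ^ k) → (Fin N → Fin d)} (hA : IsOAIndexUnity A) {T : Finset (Fin N)}
    (hT : k < T.card) (hTc : Tᶜ.card < k) : ¬ IsSeparableMat (rdm T (oaState A)) := by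
  intro hsep
  have hkN : k ≤ Fintype.card (Fin N) := hT.le.trans (Finset.card_le_univ T)
  obtain ⟨C, hTC, hC⟩ := Finset.exists_superset_card_eq hTc.le hkN
  obtain ⟨c, hcC, hcT⟩ := Finset.exists_mem_notMem_of_card_lt_card (hC ▸ hTc)
  rw [Finset.mem_compl, not_not] at hcT
  obtain ⟨a, ha⟩ := hA.exists_row hC fun _ => ⟨0, by omega⟩
  obtain ⟨b, hb⟩ := hA.exists_row hC fun i => if i = c then ⟨1, by omega⟩ else ⟨0, by omega⟩
  have hab : A a c ≠ A b c := by simp [ha c hcC, hb c hcC]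
  have hagree : ∀ i ∈ Tᶜ, A a i = A b i := by
    intro i hi
    have hic : i ≠ c := by
      rintro rfl
      exact Finset.mem_compl.mp hi hcT
    simp [ha i (hTC hi), hb i (hTC hi), hic]
  let w : {i // i ∈ T} → Fin d := fun i => if i.1 = c then A b i else A a i
  have hzero : rdm T (oaState A) w w = 0 := by
    rw [rdm_oaState, Complex.ofReal_eq_zero]
    refine mul_eq_zero_of_right _ (Finset.sum_eq_zero fun e _ => Finset.sum_eq_zero fun f _ => ?_)
    rw [if_neg]
    rintro ⟨he, -⟩
    have hea : e = a := by
      refine hA.eq_of_agree (C := T.erase c) ?_ fun i hi => ?_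
      · rw [Finset.card_erase_of_mem hcT]
        omega
      · simpa [w, Finset.ne_of_mem_erase hi] using he ⟨i, Finset.mem_of_mem_erase hi⟩
    subst hea
    exact hab (by simpa [w] using he ⟨c, hcT⟩)
  have hxy := hsep.eq_zero_of_diag_eq_zero (x := fun i => A a i) (y := fun i => A b i)
    (fun t => by by_cases h : t.1 = c <;> simp [w, h]) hzero
  rw [rdm_oaState, Complex.ofReal_eq_zero] at hxy
  refine hxy.not_gt (mul_pos (by positivity) ?_)
  refine Finset.sum_pos' (fun e _ => Finset.sum_nonneg fun f _ => by split_ifs <;> norm_num)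
    ⟨a, Finset.mem_univ a, ?_⟩
  refine Finset.sum_pos' (fun f _ => by split_ifs <;> norm_num) ⟨b, Finset.mem_univ b, ?_⟩
  rw [if_pos ⟨fun _ => rfl, fun _ => rfl, hagree⟩]
  exact one_pos

/-- Tracing out at least `k` parties leaves a mixture of computational basis states. -/
theorem IsOAIndexUnity.isSeparableMat_rdm {N d k : ℕ} (hd : d ≠ 0)
    {A : Fin (d ^ k) → (Fin N → Fin d)} (hA : IsOAIndexUnity A) {T : Finset (Fin N)}
    (hTc : k ≤ Tᶜ.card) : IsSeparableMat (rdm T (oaState A)) := by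
  refine ⟨d ^ k, fun _ => ((d ^ k : ℕ) : ℝ)⁻¹, fun a t s => if A a t = s then 1 else 0,
    fun _ => by positivity, ?_, ?_, ?_⟩
  · simp [hd]
  · intro a t
    simp [apply_ite Complex.normSq]
  · intro x y
    rw [rdm_oaState, Finset.mul_sum, Complex.ofReal_sum]
    refine Finset.sum_congr rfl fun a _ => ?_
    rw [Complex.ofReal_mul, Finset.sum_eq_single a]
    · congr 1
      simp only [apply_ite conj, map_one, map_zero, Finset.prod_mul_distrib,
        Finset.prod_ite_zero, Finset.prod_const_one, Finset.mem_univ, true_imp_iff,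
        implies_true, and_true, ite_and]
      split_ifs <;> simp
    · intro b _ hba
      rw [if_neg]
      rintro ⟨-, -, h⟩
      exact hba (hA.eq_of_agree hTc h).symm
    · simp

/-- For d ≥ 2, k ≥ 1 and N ≥ 2k, the state associated with an
orthogonal array OA(d^k, N, d, k) of index unity is (k−1)-resistant. -/
theorem oaState_resistant (d k N : ℕ) (hd : 2 ≤ d) (hk : 1 ≤ k) (hN : 2 * k ≤ N)
    (A : Fin (d ^ k) → (Fin N → Fin d)) (hA : IsOAIndexUnity A) :
    MResistant (k - 1) (oaState A) := by
  refine ⟨hA.not_isSeparableMat_rdm hd (by simp; omega) (by simp; omega),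
    fun S hS => hA.not_isSeparableMat_rdm hd ?_ ?_, fun S hS => hA.isSeparableMat_rdm (by omega) ?_⟩
  · rw [Finset.card_compl, Fintype.card_fin]
    omega
  · rw [compl_compl]
    omega
  · rw [compl_compl]
    omega
end

section
/- For all integers m ≥ 0 and N with N ≥ 2(m+1), there exists an m-resistant pure state of N qudits, whose local dimension d can be taken to be the smallest prime power satisfying d ≥ N−1. -/
open scoped ComplexConjugate

/-- A polynomial of degree less than `k` is determined by any `k` of its values, where the
coefficient of `X ^ (k - 1)` counts as the value at infinity. -/
theorem eq_zero_of_degree_lt_of_option_eval_eq_zero {F : Type*} [Field F] {k : ℕ}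
    {p : Polynomial F} (hp : p.degree < k) (S : Finset (Option F)) (hS : k ≤ S.card)
    (hinf : none ∈ S → p.coeff (k - 1) = 0) (hev : ∀ a, some a ∈ S → p.eval a = 0) :
    p = 0 := by
  classical
  refine Polynomial.eq_zero_of_degree_lt_of_eval_finset_eq_zero (Finset.eraseNone S) ?_
    fun a ha => hev a (by simpa using ha)
  by_cases h : none ∈ S
  · have hcard : k - 1 ≤ (Finset.eraseNone S).card := by
      rw [Finset.card_eraseNone_of_mem h]
      omega
    refine lt_of_lt_of_le ?_ (Nat.cast_le.mpr hcard)
    rw [Polynomial.degree_lt_iff_coeff_zero]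
    intro j hj
    rcases hj.eq_or_lt with rfl | hj
    · exact hinf h
    · exact (Polynomial.degree_lt_iff_coeff_zero p k).mp hp j (by omega)
  · rw [Finset.card_eraseNone_of_not_mem h]
    exact hp.trans_le (Nat.cast_le.mpr hS)

/-- Extended Reed–Solomon codes: over a finite field `F` there are maximum distance separable
codes of dimension `k` and any length between `k` and `|F| + 1`. -/
theorem exists_mds_code {F : Type*} [Field F] [Fintype F] {k N : ℕ}
    (hkN : k ≤ N) (hN : N ≤ Fintype.card F + 1) :
    ∃ C : Finset (Fin N → F), C.card = Fintype.card F ^ k ∧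
      ∀ x ∈ C, ∀ y ∈ C, ∀ S : Finset (Fin N), k ≤ S.card → (∀ i ∈ S, x i = y i) → x = y := by
  classical
  obtain ⟨pos⟩ : Nonempty (Fin N ↪ Option F) :=
    Function.Embedding.nonempty_of_card_le (by simpa using hN)
  let poly : (Fin k → F) → Polynomial F := fun a => ((Polynomial.degreeLTEquiv F k).symm a).1
  let enc : (Fin k → F) → Fin N → F := fun a i =>
    (pos i).elim ((poly a).coeff (k - 1)) (fun b => (poly a).eval b)
  have key : ∀ a b, ∀ S : Finset (Fin N), k ≤ S.card → (∀ i ∈ S, enc a i = enc b i) →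
      a = b := by
    intro a b S hS h
    have hzero : poly a - poly b = 0 := by
      refine eq_zero_of_degree_lt_of_option_eval_eq_zero (k := k) ?_ (S.map pos)
        (by simpa using hS) ?_ ?_
      · exact Polynomial.mem_degreeLT.mp (Submodule.sub_mem _
          ((Polynomial.degreeLTEquiv F k).symm a).2 ((Polynomial.degreeLTEquiv F k).symm b).2)
      · intro hn
        obtain ⟨i, hi, hpos⟩ := Finset.mem_map.mp hn
        have := h i hi
        simp only [enc, hpos, Option.elim] at this
        rw [Polynomial.coeff_sub, this, sub_self]
      · intro c hc
        obtain ⟨i, hi, hpos⟩ := Finset.mem_map.mp hc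
        have := h i hi
        simp only [enc, hpos, Option.elim] at this
        rw [Polynomial.eval_sub, this, sub_self]
    exact (Polynomial.degreeLTEquiv F k).symm.injective (Subtype.ext (sub_eq_zero.mp hzero))
  have hinj : Function.Injective enc := fun a b h =>
    key a b Finset.univ (by simpa using hkN) fun i _ => congrFun h i
  refine ⟨Finset.univ.image enc, ?_, ?_⟩
  · rw [Finset.card_image_of_injective _ hinj]
    simp
  · intro x hx y hy S hS h
    obtain ⟨a, -, rfl⟩ := Finset.mem_image.mp hx
    obtain ⟨b, -, rfl⟩ := Finset.mem_image.mp hy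
    rw [key a b S hS h]

section Glue

variable {N d : ℕ} (S : Finset (Fin N))

theorem glue_of_mem (x : {i // i ∈ S} → Fin d) (z : {i // i ∈ Sᶜ} → Fin d) {i : Fin N}
    (hi : i ∈ S) : glue S x z i = x ⟨i, hi⟩ := by
  simp [glue, hi]

theorem glue_of_mem_compl (x : {i // i ∈ S} → Fin d) (z : {i // i ∈ Sᶜ} → Fin d) {i : Fin N}
    (hi : i ∈ Sᶜ) : glue S x z i = z ⟨i, hi⟩ := by
  simp [glue, Finset.mem_compl.mp hi]

theorem glue_restrict (w : Fin N → Fin d) :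
    glue S (fun i => w i) (fun i => w i) = w := by
  funext i
  by_cases hi : i ∈ S <;> simp [glue, hi]

theorem glue_bijective : Function.Bijective
    (fun q : ({i // i ∈ S} → Fin d) × ({i // i ∈ Sᶜ} → Fin d) => glue S q.1 q.2) := by
  refine ⟨?_, fun w => ⟨(fun i => w i, fun i => w i), glue_restrict S w⟩⟩
  rintro ⟨x, z⟩ ⟨x', z'⟩ h
  refine Prod.ext (funext fun i => ?_) (funext fun i => ?_)
  · simpa only [glue_of_mem S _ _ i.2] using congrFun h i
  · simpa only [glue_of_mem_compl S _ _ i.2] using congrFun h i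

theorem rdm_self (ψ : (Fin N → Fin d) → ℂ) (x : {i // i ∈ S} → Fin d) :
    rdm S ψ x x = ((∑ z, Complex.normSq (ψ (glue S x z)) : ℝ) : ℂ) := by
  simp [rdm, Complex.mul_conj]

theorem sum_rdm_diag (ψ : (Fin N → Fin d) → ℂ) :
    ∑ x, ∑ z, Complex.normSq (ψ (glue S x z)) = ∑ w, Complex.normSq (ψ w) := by
  rw [← Fintype.sum_prod_type']
  exact Fintype.sum_bijective _ (glue_bijective S) _ _ fun _ => rfl

end Glue

/-- A diagonal density matrix is separable. -/
theorem isSeparableMat_of_diagonal {ι : Type} [Fintype ι] [DecidableEq ι] {d : ℕ}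
    (ρ : Matrix (ι → Fin d) (ι → Fin d) ℂ) (q : (ι → Fin d) → ℝ) (hq : ∀ x, 0 ≤ q x)
    (hsum : ∑ x, q x = 1) (hdiag : ∀ x, ρ x x = q x) (hoff : ∀ x y, x ≠ y → ρ x y = 0) :
    IsSeparableMat ρ := by
  let e := Fintype.equivFin (ι → Fin d)
  refine ⟨_, fun i => q (e.symm i), fun i t a => if a = e.symm i t then 1 else 0,
    fun i => hq _, ?_, ?_, ?_⟩
  · rw [← hsum]
    exact Equiv.sum_comp e.symm q
  · intro i t
    rw [Finset.sum_eq_single (e.symm i t)] <;> simp +contextual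
  · intro x y
    have hprod : ∀ c : ι → Fin d, (∏ t, (if x t = c t then (1 : ℂ) else 0) *
        conj (if y t = c t then (1 : ℂ) else 0)) = if x = c ∧ y = c then 1 else 0 := by
      intro c
      split_ifs with h
      · simp [h.1, h.2]
      · have : ∃ t, ¬ (x t = c t ∧ y t = c t) := by
          by_contra! hc
          exact h ⟨funext fun t => (hc t).1, funext fun t => (hc t).2⟩
        obtain ⟨t, ht⟩ := this
        refine Finset.prod_eq_zero (Finset.mem_univ t) ?_
        by_cases h1 : x t = c t <;> simp_all
    simp only [hprod]
    rw [Equiv.sum_comp e.symm fun c => (q c : ℂ) * if x = c ∧ y = c then 1 else 0]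
    by_cases hxy : x = y
    · subst hxy
      simp [hdiag]
    · rw [hoff x y hxy]
      refine (Finset.sum_eq_zero fun c _ => ?_).symm
      rw [if_neg, mul_zero]
      rintro ⟨rfl, h⟩
      exact hxy h.symm

/-- The support of a separable density matrix is closed under exchanging one local level between
two coherently superposed basis states. -/
theorem IsSeparableMat.diag_update_ne_zero {ι : Type} [Fintype ι] [DecidableEq ι] {d : ℕ}
    {ρ : Matrix (ι → Fin d) (ι → Fin d) ℂ} (hρ : IsSeparableMat ρ) {x y : ι → Fin d}
    (hxy : ρ x y ≠ 0) (t : ι) :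
    ρ (Function.update x t (y t)) (Function.update x t (y t)) ≠ 0 := by
  obtain ⟨n, p, φ, hp, -, -, hφ⟩ := hρ
  rw [hφ] at hxy
  obtain ⟨i, -, hi⟩ := Finset.exists_ne_zero_of_sum_ne_zero hxy
  have hpi : p i ≠ 0 := by
    intro h
    simp [h] at hi
  have hloc := Finset.prod_ne_zero_iff.mp (right_ne_zero_of_mul hi)
  set w := Function.update x t (y t)
  have hw : ∀ s, φ i s (w s) ≠ 0 := by
    intro s
    have hs := hloc s (Finset.mem_univ s)
    by_cases h : s = t
    · subst h
      simpa [w] using right_ne_zero_of_mul hs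
    · simpa [w, h] using left_ne_zero_of_mul hs
  have hreal : ρ w w = ((∑ j, p j * ∏ s, Complex.normSq (φ j s (w s)) : ℝ) : ℂ) := by
    simp [hφ, Complex.mul_conj]
  rw [hreal, Complex.ofReal_ne_zero]
  refine (Finset.sum_pos' (fun j _ => mul_nonneg (hp j)
    (Finset.prod_nonneg fun s _ => Complex.normSq_nonneg _)) ⟨i, Finset.mem_univ i, ?_⟩).ne'
  exact mul_pos ((hp i).lt_of_ne' hpi)
    (Finset.prod_pos fun s _ => Complex.normSq_pos.mpr (hw s))

/-- The uniform superposition of the codewords of `C`. -/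
noncomputable def codeState {N d : ℕ} (C : Finset (Fin N → Fin d)) (w : Fin N → Fin d) : ℂ :=
  if w ∈ C then (((Real.sqrt C.card)⁻¹ : ℝ) : ℂ) else 0

section CodeState

variable {N d : ℕ} {C : Finset (Fin N → Fin d)}

theorem normSq_codeState (w : Fin N → Fin d) :
    Complex.normSq (codeState C w) = if w ∈ C then (C.card : ℝ)⁻¹ else 0 := by
  unfold codeState
  split_ifs
  · rw [Complex.normSq_ofReal, ← mul_inv, Real.mul_self_sqrt (Nat.cast_nonneg _)]
  · simp

theorem sum_normSq_codeState (hC : C.Nonempty) :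
    ∑ w, Complex.normSq (codeState C w) = 1 := by
  have : (C.card : ℝ) ≠ 0 := by exact_mod_cast hC.card_ne_zero
  simp [normSq_codeState, this]

theorem mem_of_codeState_ne_zero {w : Fin N → Fin d} (hw : codeState C w ≠ 0) : w ∈ C := by
  by_contra h
  exact hw (by simp [codeState, h])

theorem rdm_codeState_ne_zero (T : Finset (Fin N)) {x y : Fin N → Fin d} (hx : x ∈ C)
    (hy : y ∈ C) (hxy : ∀ i ∈ Tᶜ, x i = y i) :
    rdm T (codeState C) (fun i => x i) (fun i => y i) ≠ 0 := by
  let r : (Fin N → Fin d) → ℝ := fun w => if w ∈ C then (Real.sqrt C.card)⁻¹ else 0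
  have hr : ∀ w, codeState C w = (r w : ℂ) := by
    intro w
    simp only [codeState, r]
    split_ifs <;> simp
  have hr0 : ∀ w, 0 ≤ r w := by
    intro w
    simp only [r]
    split_ifs <;> positivity
  have hcard : (0 : ℝ) < C.card := by exact_mod_cast Finset.card_pos.mpr ⟨x, hx⟩
  have hr1 : ∀ w ∈ C, 0 < r w := by
    intro w hw
    simp only [r, hw, if_true]
    positivity
  have hreal : rdm T (codeState C) (fun i => x i) (fun i => y i) =
      ((∑ z, r (glue T (fun i => x i) z) * r (glue T (fun i => y i) z) : ℝ) : ℂ) := by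
    simp [rdm, hr]
  rw [hreal, Complex.ofReal_ne_zero]
  refine (Finset.sum_pos' (fun z _ => mul_nonneg (hr0 _) (hr0 _))
    ⟨fun i : {i // i ∈ Tᶜ} => x i, Finset.mem_univ _, ?_⟩).ne'
  have hyx : (fun i : {i // i ∈ Tᶜ} => x i) = fun i : {i // i ∈ Tᶜ} => y i :=
    funext fun i => hxy i i.2
  rw [glue_restrict, hyx, glue_restrict]
  exact mul_pos (hr1 x hx) (hr1 y hy)

theorem not_isSeparableMat_rdm_codeState {k : ℕ}
    (hC : ∀ x ∈ C, ∀ y ∈ C, ∀ S : Finset (Fin N), k ≤ S.card → (∀ i ∈ S, x i = y i) → x = y)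
    (T : Finset (Fin N)) (hT : k < T.card) (hcard : d ^ Tᶜ.card < C.card) :
    ¬ IsSeparableMat (rdm T (codeState C)) := by
  classical
  intro hsep
  obtain ⟨x, hx, y, hy, hne, hagree⟩ : ∃ x ∈ C, ∃ y ∈ C, x ≠ y ∧
      (fun i : {i // i ∈ Tᶜ} => x i) = fun i : {i // i ∈ Tᶜ} => y i := by
    refine Finset.exists_ne_map_eq_of_card_lt_of_maps_to
      (t := (Finset.univ : Finset ({i // i ∈ Tᶜ} → Fin d))) ?_ fun _ _ => Finset.mem_univ _
    rw [Finset.card_univ, Fintype.card_fun, Fintype.card_coe, Fintype.card_fin]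
    exact hcard
  have hagree' : ∀ i ∈ Tᶜ, x i = y i := fun i hi => congrFun hagree ⟨i, hi⟩
  obtain ⟨t, ht⟩ := Function.ne_iff.mp hne
  have htT : t ∈ T := by
    by_contra h
    exact ht (hagree' t (Finset.mem_compl.mpr h))
  have hdiag := hsep.diag_update_ne_zero (rdm_codeState_ne_zero T hx hy hagree') ⟨t, htT⟩
  obtain ⟨z, -, hz⟩ := Finset.exists_ne_zero_of_sum_ne_zero hdiag
  have hmem := mem_of_codeState_ne_zero (left_ne_zero_of_mul hz)
  have heq := hC _ hmem x hx (T.erase t)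
    (by rw [Finset.card_erase_of_mem htT]; omega) (by
      intro i hi
      obtain ⟨hit, hiT⟩ := Finset.mem_erase.mp hi
      rw [glue_of_mem T _ _ hiT, Function.update_of_ne]
      simpa [Subtype.ext_iff] using hit)
  apply ht
  rw [← congrFun heq t, glue_of_mem T _ _ htT, Function.update_self]

theorem isSeparableMat_rdm_codeState {k : ℕ} (hne : C.Nonempty)
    (hC : ∀ x ∈ C, ∀ y ∈ C, ∀ S : Finset (Fin N), k ≤ S.card → (∀ i ∈ S, x i = y i) → x = y)
    (T : Finset (Fin N)) (hT : k ≤ Tᶜ.card) :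
    IsSeparableMat (rdm T (codeState C)) := by
  refine isSeparableMat_of_diagonal _ _
    (fun x => Finset.sum_nonneg fun z _ => Complex.normSq_nonneg _)
    ((sum_rdm_diag T _).trans (sum_normSq_codeState hne)) (rdm_self T _) ?_
  intro x y hxy
  refine Finset.sum_eq_zero fun z _ => ?_
  by_contra hz
  have heq := hC _ (mem_of_codeState_ne_zero (left_ne_zero_of_mul hz)) _
    (mem_of_codeState_ne_zero (w := glue T y z) (by simpa using right_ne_zero_of_mul hz)) Tᶜ hT
    fun i hi => by rw [glue_of_mem_compl T _ _ hi, glue_of_mem_compl T _ _ hi]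
  exact hxy (congrArg Prod.fst ((glue_bijective T).1 (a₁ := (x, z)) (a₂ := (y, z)) heq))

end CodeState

/-- For all m ≥ 0 and N ≥ 2(m+1), there exists an m-resistant
(normalized) pure state of N qudits whose local dimension d is the smallest prime
power with d ≥ N−1. -/
theorem exists_mResistant (m N : ℕ) (hN : 2 * (m + 1) ≤ N) :
    ∃ d : ℕ, IsPrimePow d ∧ N - 1 ≤ d ∧
      (∀ d' : ℕ, IsPrimePow d' → N - 1 ≤ d' → d ≤ d') ∧
      ∃ ψ : (Fin N → Fin d) → ℂ,
        (∑ x, Complex.normSq (ψ x)) = 1 ∧ MResistant m ψ := by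
  classical
  have hex : ∃ d : ℕ, IsPrimePow d ∧ N - 1 ≤ d := by
    obtain ⟨p, hp, hprime⟩ := Nat.exists_infinite_primes (N - 1)
    exact ⟨p, hprime.isPrimePow, hp⟩
  obtain ⟨hpp, hle⟩ := Nat.find_spec hex
  have hmin : ∀ d' : ℕ, IsPrimePow d' → N - 1 ≤ d' → Nat.find hex ≤ d' :=
    fun d' h h' => Nat.find_min' hex ⟨h, h'⟩
  generalize Nat.find hex = d at hpp hle hmin
  refine ⟨d, hpp, hle, hmin, ?_⟩
  have hd : 1 < d := hpp.one_lt
  obtain ⟨C, hcard, hC⟩ : ∃ C : Finset (Fin N → Fin d), C.card = d ^ (m + 1) ∧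
      ∀ x ∈ C, ∀ y ∈ C, ∀ S : Finset (Fin N), m + 1 ≤ S.card → (∀ i ∈ S, x i = y i) →
        x = y := by
    obtain ⟨hF⟩ := Fintype.nonempty_field_iff.mpr
      (show IsPrimePow (Fintype.card (Fin d)) by simpa using hpp)
    simpa using @exists_mds_code (Fin d) hF _ (m + 1) N (by omega)
      (by rw [Fintype.card_fin]; omega)
  have hne : C.Nonempty := Finset.card_pos.mp (by rw [hcard]; positivity)
  refine ⟨codeState C, sum_normSq_codeState hne, ?_, fun S hS => ?_, fun S hS => ?_⟩
  · refine not_isSeparableMat_rdm_codeState hC _ ?_ ?_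
    · rw [Finset.card_fin]
      omega
    · rw [hcard]
      exact Nat.pow_lt_pow_right hd (by simp)
  · refine not_isSeparableMat_rdm_codeState hC _ ?_ ?_
    · rw [Finset.card_compl, Fintype.card_fin]
      omega
    · rw [hcard, compl_compl, hS]
      exact Nat.pow_lt_pow_right hd (Nat.lt_succ_self m)
  · refine isSeparableMat_rdm_codeState hne hC _ ?_
    rw [compl_compl, hS]
end

section
/- Let N ≥ 1 and let H be a subgroup of the symmetric group S_N of permutations of Fin N. Define the state ψ : (Fin N → Fin N) → ℂ of N qudits with N levels by ψ(f) = 1/√|H| if f, viewed as a map Fin N → Fin N, is a permutation belonging to H, and ψ(f) = 0 otherwise. Then ψ is exactly H-symmetric: for every permutation τ ∈ S_N acting on the subsystems by (τ·ψ)(f) = ψ(f∘τ), one has τ·ψ = ψ if and only if τ ∈ H. -/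
open scoped Classical

/-- For a subgroup H ≤ S_N, the state ψ(f) = 1/√|H| if f is (as a map)
a permutation belonging to H and ψ(f) = 0 otherwise, is exactly H-symmetric: for every
permutation τ acting on subsystems by (τ·ψ)(f) = ψ(f∘τ), one has τ·ψ = ψ iff τ ∈ H. -/
theorem subgroup_state_exactly_symmetric (N : ℕ) (hN : 1 ≤ N)
    (H : Subgroup (Equiv.Perm (Fin N))) (ψ : (Fin N → Fin N) → ℂ)
    (hψ : ∀ f : Fin N → Fin N,
      ψ f = if ∃ σ ∈ H, (σ : Fin N → Fin N) = f
            then ((Real.sqrt (Nat.card H) : ℂ))⁻¹ else 0) :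
    ∀ τ : Equiv.Perm (Fin N), (∀ f : Fin N → Fin N, ψ (f ∘ τ) = ψ f) ↔ τ ∈ H := by
  have hc : ((Real.sqrt (Nat.card H) : ℂ))⁻¹ ≠ 0 := by
    have hpos : 0 < (Nat.card H : ℝ) := Nat.cast_pos.mpr Nat.card_pos
    exact inv_ne_zero (Complex.ofReal_ne_zero.mpr (Real.sqrt_pos.mpr hpos).ne')
  intro τ
  constructor
  · intro h
    have h1 : ψ id ≠ 0 := by
      rw [hψ, if_pos ⟨1, H.one_mem, rfl⟩]
      exact hc
    rw [← h id, Function.id_comp, hψ] at h1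
    obtain ⟨σ, hσ, hστ⟩ := (ite_ne_right_iff.mp h1).1
    rwa [← DFunLike.coe_injective hστ]
  · intro hτ f
    have key : (∃ σ ∈ H, (σ : Fin N → Fin N) = f ∘ τ) ↔
        ∃ σ ∈ H, (σ : Fin N → Fin N) = f := by
      constructor
      · rintro ⟨σ, hσ, h⟩
        refine ⟨σ * τ⁻¹, H.mul_mem hσ (H.inv_mem hτ), funext fun x => ?_⟩
        simpa using congrFun h (τ⁻¹ x)
      · rintro ⟨σ, hσ, rfl⟩
        exact ⟨σ * τ, H.mul_mem hσ hτ, rfl⟩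
    simp only [hψ, key]
end

section
/- Let G = (V,E) be a connected k-uniform hypergraph (k ≥ 1) and let V = V₁ ⊎ V₂ be a partition of the vertex set into two nonempty sets. Then the excitation state |G⟩ is separable across the bipartition V₁|V₂ — i.e. there exist f : (V₁ → Fin 2) → ℂ and g : (V₂ → Fin 2) → ℂ with |G⟩(x) = f(x|_{V₁})·g(x|_{V₂}) for all x : V → Fin 2 — if and only if G is a product hypergraph with respect to V₁|V₂, i.e. there exist nonempty families E₁ of nonempty subsets of V₁ and E₂ of nonempty subsets of V₂ such that E = {e₁ ∪ e₂ : e₁ ∈ E₁, e₂ ∈ E₂}. -/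
/-- The excitation state of a hypergraph with edge set `E`:
coefficient 1/√|E| on basis labels whose set of excited vertices is an edge, 0 else. -/
noncomputable def excState {V : Type} [Fintype V] [DecidableEq V]
    (E : Finset (Finset V)) : (V → Fin 2) → ℂ := fun x =>
  if (Finset.univ.filter (fun v => x v = 1)) ∈ E
  then ((Real.sqrt E.card : ℂ))⁻¹ else 0

/-- The coefficient of an excitation state at the indicator of `e` is nonzero iff `e` is an edge. -/
lemma excState_indicator_ne_zero_iff {V : Type} [Fintype V] [DecidableEq V]
    (E : Finset (Finset V)) (e : Finset V) :
    excState E (fun v => if v ∈ e then 1 else 0) ≠ 0 ↔ e ∈ E := by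
  have hsupp : (Finset.univ.filter fun v => (if v ∈ e then (1 : Fin 2) else 0) = 1) = e := by
    ext v
    simp
  unfold excState
  rw [hsupp]
  by_cases he : e ∈ E
  · have hcard : E.card ≠ 0 := Finset.card_ne_zero_of_mem he
    simp [he, hcard]
  · simp [he]

/-- The edge set of a hypergraph with separable excitation state is closed under recombining
the two parts of edges. -/
lemma inter_union_inter_mem_of_excState_eq_mul {V : Type} [Fintype V] [DecidableEq V]
    {E : Finset (Finset V)} {S : Finset V}
    {f : ({v // v ∈ S} → Fin 2) → ℂ} {g : ({v // v ∈ Sᶜ} → Fin 2) → ℂ}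
    (hfg : ∀ x : V → Fin 2, excState E x = f (fun v => x v.1) * g (fun v => x v.1))
    {a b : Finset V} (ha : a ∈ E) (hb : b ∈ E) : (a ∩ S) ∪ (b ∩ Sᶜ) ∈ E := by
  rw [← excState_indicator_ne_zero_iff, hfg] at ha hb ⊢
  have hf : (fun v : {v // v ∈ S} => if v.1 ∈ (a ∩ S) ∪ (b ∩ Sᶜ) then (1 : Fin 2) else 0) =
      fun v => if v.1 ∈ a then 1 else 0 := by
    funext v
    simp [v.2]
  have hg : (fun v : {v // v ∈ Sᶜ} => if v.1 ∈ (a ∩ S) ∪ (b ∩ Sᶜ) then (1 : Fin 2) else 0) =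
      fun v => if v.1 ∈ b then 1 else 0 := by
    funext v
    have hv := Finset.mem_compl.mp v.2
    simp [hv]
  rw [hf, hg]
  exact mul_ne_zero (left_ne_zero_of_mul ha) (right_ne_zero_of_mul hb)

/-- In a uniform hypergraph closed under recombination with respect to `S`, all edges meet `S`
in equally many vertices. -/
lemma card_inter_eq_of_recombination {V : Type} [Fintype V] [DecidableEq V] {k : ℕ}
    {E : Finset (Finset V)} (hunif : ∀ e ∈ E, e.card = k) {S : Finset V}
    (hmix : ∀ a ∈ E, ∀ b ∈ E, (a ∩ S) ∪ (b ∩ Sᶜ) ∈ E) {a b : Finset V}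
    (ha : a ∈ E) (hb : b ∈ E) : (a ∩ S).card = (b ∩ S).card := by
  have hcard : ∀ c : Finset V, ((c ∩ S) ∪ (b ∩ Sᶜ)).card = (c ∩ S).card + (b ∩ Sᶜ).card :=
    fun c => Finset.card_union_of_disjoint
      (disjoint_compl_right.mono Finset.inter_subset_right Finset.inter_subset_right)
  have h₁ := hunif _ (hmix a ha b hb)
  have h₂ := hunif _ (hmix b hb b hb)
  rw [hcard] at h₁ h₂
  omega

/-- In a hypergraph whose vertices are joined by chains of edges, every vertex that is not the
only one lies in an edge. -/
lemma exists_edge_mem_of_chain {V : Type} {E : Finset (Finset V)} {u v : V} (huv : u ≠ v)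
    (h : Relation.ReflTransGen (fun a b => ∃ e ∈ E, a ∈ e ∧ b ∈ e) u v) :
    ∃ e ∈ E, u ∈ e := by
  rcases h.cases_head with h | ⟨_, ⟨e, he, hu, _⟩, _⟩
  · exact absurd h huv
  · exact ⟨e, he, hu⟩

/-- The excitation state of a product hypergraph is separable. -/
lemma exists_excState_eq_mul_of_product {V : Type} [Fintype V] [DecidableEq V]
    {E E₁ E₂ : Finset (Finset V)} {S : Finset V} (h₁ : ∀ e ∈ E₁, e ⊆ S) (h₂ : ∀ e ∈ E₂, e ⊆ Sᶜ)
    (hE : ∀ e : Finset V, e ∈ E ↔ ∃ e₁ ∈ E₁, ∃ e₂ ∈ E₂, e = e₁ ∪ e₂) :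
    ∃ (f : ({v // v ∈ S} → Fin 2) → ℂ) (g : ({v // v ∈ Sᶜ} → Fin 2) → ℂ),
      ∀ x : V → Fin 2, excState E x = f (fun v => x v.1) * g (fun v => x v.1) := by
  have hsplit : ∀ e : Finset V, e ∈ E ↔ e ∩ S ∈ E₁ ∧ e ∩ Sᶜ ∈ E₂ := by
    intro e
    rw [hE]
    constructor
    · rintro ⟨e₁, he₁, e₂, he₂, rfl⟩
      have hS : (e₁ ∪ e₂) ∩ S = e₁ := by
        ext v
        have := @h₁ e₁ he₁ v
        have := @h₂ e₂ he₂ v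
        simp only [Finset.mem_inter, Finset.mem_union, Finset.mem_compl] at *
        tauto
      have hSc : (e₁ ∪ e₂) ∩ Sᶜ = e₂ := by
        ext v
        have := @h₁ e₁ he₁ v
        have := @h₂ e₂ he₂ v
        simp only [Finset.mem_inter, Finset.mem_union, Finset.mem_compl] at *
        tauto
      rw [hS, hSc]
      exact ⟨he₁, he₂⟩
    · rintro ⟨he₁, he₂⟩
      refine ⟨_, he₁, _, he₂, ?_⟩
      rw [← Finset.inter_union_distrib_left, Finset.union_compl, Finset.inter_univ]
  let supp (T : Finset V) (y : {v // v ∈ T} → Fin 2) : Finset V :=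
    Finset.univ.filter fun v => ∃ h : v ∈ T, y ⟨v, h⟩ = 1
  have hsupp : ∀ (T : Finset V) (x : V → Fin 2),
      supp T (fun v => x v.1) = (Finset.univ.filter fun v => x v = 1) ∩ T := by
    intro T x
    ext v
    simp [supp, and_comm]
  refine ⟨fun y => if supp S y ∈ E₁ then ((Real.sqrt E.card : ℂ))⁻¹ else 0,
    fun y => if supp Sᶜ y ∈ E₂ then 1 else 0, fun x => ?_⟩
  simp only [hsupp, excState, hsplit]
  split_ifs <;> simp_all

/-- For a connected k-uniform hypergraph (k ≥ 1) and a partition of the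
vertices into nonempty sets V₁ and V₂ = V₁ᶜ, the excitation state |G⟩ is separable
across V₁|V₂ iff G is a product hypergraph with respect to V₁|V₂. -/
theorem excState_separable_iff_product {V : Type} [Fintype V] [DecidableEq V]
    (k : ℕ) (hk : 1 ≤ k) (E : Finset (Finset V)) (hEne : E.Nonempty)
    (hedge : ∀ e ∈ E, e.Nonempty) (hunif : ∀ e ∈ E, e.card = k)
    (hconn : ∀ u v : V,
      Relation.ReflTransGen (fun a b => ∃ e ∈ E, a ∈ e ∧ b ∈ e) u v)
    (V₁ : Finset V) (hV₁ : V₁.Nonempty) (hV₂ : V₁ᶜ.Nonempty) :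
    (∃ (f : ({v // v ∈ V₁} → Fin 2) → ℂ) (g : ({v // v ∈ V₁ᶜ} → Fin 2) → ℂ),
        ∀ x : V → Fin 2,
          excState E x = f (fun v => x v.1) * g (fun v => x v.1)) ↔
    (∃ E₁ E₂ : Finset (Finset V),
        E₁.Nonempty ∧ E₂.Nonempty ∧
        (∀ e₁ ∈ E₁, e₁.Nonempty ∧ e₁ ⊆ V₁) ∧
        (∀ e₂ ∈ E₂, e₂.Nonempty ∧ e₂ ⊆ V₁ᶜ) ∧
        ∀ e : Finset V, e ∈ E ↔ ∃ e₁ ∈ E₁, ∃ e₂ ∈ E₂, e = e₁ ∪ e₂) := by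
  constructor
  · rintro ⟨f, g, hfg⟩
    have hmix : ∀ a ∈ E, ∀ b ∈ E, (a ∩ V₁) ∪ (b ∩ V₁ᶜ) ∈ E :=
      fun a ha b hb => inter_union_inter_mem_of_excState_eq_mul hfg ha hb
    have hmix' : ∀ a ∈ E, ∀ b ∈ E, (a ∩ V₁ᶜ) ∪ (b ∩ V₁ᶜᶜ) ∈ E := by
      intro a ha b hb
      rw [compl_compl, Finset.union_comm]
      exact hmix b hb a ha
    obtain ⟨u, hu⟩ := hV₁
    obtain ⟨v, hv⟩ := hV₂
    have huv : u ≠ v := fun h => Finset.mem_compl.mp hv (h ▸ hu)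
    obtain ⟨a, ha, hua⟩ := exists_edge_mem_of_chain huv (hconn u v)
    obtain ⟨b, hb, hvb⟩ := exists_edge_mem_of_chain huv.symm (hconn v u)
    refine ⟨E.image (· ∩ V₁), E.image (· ∩ V₁ᶜ), hEne.image _, hEne.image _, ?_, ?_, ?_⟩
    · rw [Finset.forall_mem_image]
      intro e he
      refine ⟨Finset.card_pos.mp ?_, Finset.inter_subset_right⟩
      rw [card_inter_eq_of_recombination hunif hmix he ha]
      exact Finset.card_pos.mpr ⟨u, Finset.mem_inter.mpr ⟨hua, hu⟩⟩
    · rw [Finset.forall_mem_image]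
      intro e he
      refine ⟨Finset.card_pos.mp ?_, Finset.inter_subset_right⟩
      rw [card_inter_eq_of_recombination hunif hmix' he hb]
      exact Finset.card_pos.mpr ⟨v, Finset.mem_inter.mpr ⟨hvb, hv⟩⟩
    · intro e
      constructor
      · intro he
        refine ⟨_, Finset.mem_image_of_mem _ he, _, Finset.mem_image_of_mem _ he, ?_⟩
        rw [← Finset.inter_union_distrib_left, Finset.union_compl, Finset.inter_univ]
      · rintro ⟨e₁, he₁, e₂, he₂, rfl⟩
        obtain ⟨c, hc, rfl⟩ := Finset.mem_image.mp he₁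
        obtain ⟨d, hd, rfl⟩ := Finset.mem_image.mp he₂
        exact hmix c hc d hd
  · rintro ⟨E₁, E₂, -, -, h₁, h₂, hE⟩
    exact exists_excState_eq_mul_of_product (fun e he => (h₁ e he).2)
      (fun e he => (h₂ e he).2) hE
end

section
/- Let G = (V,E) be a connected graph (each edge a 2-element subset of V, E nonempty) and let V = V₁ ⊎ V₂ be a partition of the vertex set into two nonempty sets. Then the excitation state |G⟩ is separable across the bipartition V₁|V₂ if and only if G is the complete bipartite graph K_{V₁,V₂}, i.e. E = {{u,w} : u ∈ V₁, w ∈ V₂}; and in that case |G⟩ factors as a product of two W states: |G⟩(x) = W_{V₁}(x|_{V₁})·W_{V₂}(x|_{V₂}) for all x : V → Fin 2. -/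
/-- The W state on a finite set of qubits `A`. -/
noncomputable def Wstate (A : Type) [Fintype A] [DecidableEq A] : (A → Fin 2) → ℂ :=
  fun y => if (Finset.univ.filter (fun a => y a = 1)).card = 1
           then ((Real.sqrt (Fintype.card A) : ℂ))⁻¹ else 0

/-- The excitation state does not vanish exactly on the indicator functions of the edges. -/
theorem excState_ne_zero_iff {V : Type} [Fintype V] [DecidableEq V]
    (E : Finset (Finset V)) (x : V → Fin 2) :
    excState E x ≠ 0 ↔ Finset.univ.filter (fun v => x v = 1) ∈ E := by
  unfold excState
  split_ifs with h
  · have hpos : 0 < E.card := Finset.card_pos.mpr ⟨_, h⟩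
    have hsqrt : Real.sqrt E.card ≠ 0 := (Real.sqrt_pos.mpr (by exact_mod_cast hpos)).ne'
    simpa [h] using hsqrt
  · simp [h]

/-- If the excitation state is separable across `A | Aᶜ`, then the part of an edge inside `A`
can be combined with the part of any other edge outside `A`. -/
theorem inter_union_inter_mem_of_excState_separable {V : Type} [Fintype V] [DecidableEq V]
    {E : Finset (Finset V)} {A : Finset V}
    {f : ({v // v ∈ A} → Fin 2) → ℂ} {g : ({v // v ∈ Aᶜ} → Fin 2) → ℂ}
    (hfg : ∀ x : V → Fin 2, excState E x = f (fun v => x v.1) * g (fun v => x v.1))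
    {d e : Finset V} (hd : d ∈ E) (he : e ∈ E) : d ∩ A ∪ e ∩ Aᶜ ∈ E := by
  have key : ∀ s : Finset V, s ∈ E ↔
      f (fun v => if v.1 ∈ s then 1 else 0) ≠ 0 ∧ g (fun v => if v.1 ∈ s then 1 else 0) ≠ 0 := by
    intro s
    have h := excState_ne_zero_iff E (fun v => if v ∈ s then 1 else 0)
    rw [hfg, mul_ne_zero_iff] at h
    rw [h]
    simp
  rw [key]
  have h₁ : (fun v : {v // v ∈ A} => if v.1 ∈ d ∩ A ∪ e ∩ Aᶜ then (1 : Fin 2) else 0) =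
      fun v => if v.1 ∈ d then 1 else 0 := by
    ext ⟨v, hv⟩
    simp [hv]
  have h₂ : (fun v : {v // v ∈ Aᶜ} => if v.1 ∈ d ∩ A ∪ e ∩ Aᶜ then (1 : Fin 2) else 0) =
      fun v => if v.1 ∈ e then 1 else 0 := by
    ext ⟨v, hv⟩
    have hv' : v ∉ A := Finset.mem_compl.mp hv
    simp [hv']
  rw [h₁, h₂]
  exact ⟨((key d).mp hd).1, ((key e).mp he).2⟩

/-- A set is a pair crossing the bipartition `A | Aᶜ` iff it has one element on each side. -/
theorem exists_eq_pair_iff_card_inter {V : Type} [Fintype V] [DecidableEq V]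
    (A e : Finset V) :
    (∃ u ∈ A, ∃ w ∈ Aᶜ, e = {u, w}) ↔ (e ∩ A).card = 1 ∧ (e ∩ Aᶜ).card = 1 := by
  constructor
  · rintro ⟨u, hu, w, hw, rfl⟩
    have hw' : w ∉ A := Finset.mem_compl.mp hw
    constructor <;> rw [Finset.card_eq_one]
    · exact ⟨u, by ext v; simp; grind⟩
    · exact ⟨w, by ext v; simp; grind⟩
  · rintro ⟨h₁, h₂⟩
    obtain ⟨u, hu⟩ := Finset.card_eq_one.mp h₁
    obtain ⟨w, hw⟩ := Finset.card_eq_one.mp h₂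
    have hu' : u ∈ e ∩ A := by simp [hu]
    have hw' : w ∈ e ∩ Aᶜ := by simp [hw]
    refine ⟨u, (Finset.mem_inter.mp hu').2, w, (Finset.mem_inter.mp hw').2, ?_⟩
    have hunion : e ∩ A ∪ e ∩ Aᶜ = e := by
      rw [← Finset.inter_union_distrib_left, Finset.union_compl, Finset.inter_univ]
    rw [← hunion, hu, hw]
    rfl

theorem card_inter_add_card_inter_compl {V : Type} [Fintype V] [DecidableEq V]
    (A e : Finset V) : (e ∩ A).card + (e ∩ Aᶜ).card = e.card := by
  rw [← Finset.sdiff_eq_inter_compl, Finset.card_inter_add_card_sdiff]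

theorem card_filter_subtype_eq_card_inter {V : Type} [Fintype V] [DecidableEq V]
    (A : Finset V) (x : V → Fin 2) :
    (Finset.univ.filter (fun a : {v // v ∈ A} => x a.1 = 1)).card =
      (Finset.univ.filter (fun v => x v = 1) ∩ A).card := by
  rw [← Finset.card_map (Function.Embedding.subtype (· ∈ A))]
  congr 1
  ext v
  simp [and_comm]

/-- The complete bipartite graph on `A | Aᶜ` has `|A| * |Aᶜ|` edges. -/
theorem card_eq_mul_of_completeBipartite {V : Type} [Fintype V] [DecidableEq V]
    {E : Finset (Finset V)} {A : Finset V}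
    (hE : ∀ e : Finset V, e ∈ E ↔ ∃ u ∈ A, ∃ w ∈ Aᶜ, e = {u, w}) :
    E.card = A.card * Aᶜ.card := by
  have himage : E = (A ×ˢ Aᶜ).image (fun p => {p.1, p.2}) := by
    ext e
    rw [hE]
    simp only [Finset.mem_image, Finset.mem_product, Prod.exists]
    grind
  rw [himage, Finset.card_image_of_injOn, Finset.card_product]
  rintro ⟨u, w⟩ h ⟨u', w'⟩ h' heq
  replace heq : ({u, w} : Finset V) = {u', w'} := heq
  simp only [Finset.coe_product, Set.mem_prod, Finset.mem_coe, Finset.mem_compl] at h h'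
  have hu : u ∈ ({u', w'} : Finset V) := by simp [← heq]
  have hw : w ∈ ({u', w'} : Finset V) := by simp [← heq]
  simp only [Finset.mem_insert, Finset.mem_singleton] at hu hw
  grind

theorem excState_completeBipartite {V : Type} [Fintype V] [DecidableEq V]
    {E : Finset (Finset V)} {A : Finset V}
    (hE : ∀ e : Finset V, e ∈ E ↔ ∃ u ∈ A, ∃ w ∈ Aᶜ, e = {u, w}) (x : V → Fin 2) :
    excState E x =
      Wstate {v // v ∈ A} (fun v => x v.1) * Wstate {v // v ∈ Aᶜ} (fun v => x v.1) := by
  simp only [excState, Wstate, hE, exists_eq_pair_iff_card_inter,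
    card_filter_subtype_eq_card_inter, ite_zero_mul_ite_zero, Fintype.card_coe,
    card_eq_mul_of_completeBipartite hE]
  congr 1
  rw [Nat.cast_mul, Real.sqrt_mul (Nat.cast_nonneg _), Complex.ofReal_mul, mul_inv]

/-- In a connected hypergraph, some edge crosses any bipartition into nonempty parts. -/
theorem exists_crossing_edge {V : Type} {E : Finset (Finset V)} {A : Finset V} {u w : V}
    (h : Relation.ReflTransGen (fun a b => ∃ e ∈ E, a ∈ e ∧ b ∈ e) u w)
    (hu : u ∈ A) (hw : w ∉ A) : ∃ e ∈ E, ∃ a ∈ e, ∃ b ∈ e, a ∈ A ∧ b ∉ A := by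
  induction h with
  | refl => exact absurd hu hw
  | @tail b c _ hbc ih =>
    by_cases hb : b ∈ A
    · obtain ⟨e, he, hbe, hce⟩ := hbc
      exact ⟨e, he, b, hbe, c, hce, hb, hw⟩
    · exact ih hb

/-- In a connected graph, if the excitation state is separable across `A | Aᶜ` then the graph is
the complete bipartite graph on `A | Aᶜ`. -/
theorem completeBipartite_of_excState_separable {V : Type} [Fintype V] [DecidableEq V]
    {E : Finset (Finset V)} (hunif : ∀ e ∈ E, e.card = 2)
    (hconn : ∀ u v : V, Relation.ReflTransGen (fun a b => ∃ e ∈ E, a ∈ e ∧ b ∈ e) u v)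
    {A : Finset V} (hA : A.Nonempty) (hA' : Aᶜ.Nonempty)
    {f : ({v // v ∈ A} → Fin 2) → ℂ} {g : ({v // v ∈ Aᶜ} → Fin 2) → ℂ}
    (hfg : ∀ x : V → Fin 2, excState E x = f (fun v => x v.1) * g (fun v => x v.1))
    (e : Finset V) : e ∈ E ↔ ∃ u ∈ A, ∃ w ∈ Aᶜ, e = {u, w} := by
  obtain ⟨a, ha⟩ := hA
  obtain ⟨b, hb⟩ := hA'
  have hcross : ∀ d ∈ E, (d ∩ A).card = 1 ∧ (d ∩ Aᶜ).card = 1 := by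
    obtain ⟨c, hc, p, hpc, q, hqc, hp, hq⟩ :=
      exists_crossing_edge (hconn a b) ha (Finset.mem_compl.mp hb)
    have hp₀ : 0 < (c ∩ A).card := Finset.card_pos.mpr ⟨p, by simp [hpc, hp]⟩
    have hq₀ : 0 < (c ∩ Aᶜ).card := Finset.card_pos.mpr ⟨q, by simp [hqc, hq]⟩
    have hc₂ := card_inter_add_card_inter_compl A c
    rw [hunif c hc] at hc₂
    intro d hd
    have hd₂ := card_inter_add_card_inter_compl A d
    rw [hunif d hd] at hd₂
    have hdc := hunif _ (inter_union_inter_mem_of_excState_separable hfg hd hc)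
    rw [Finset.card_union_of_disjoint (disjoint_compl_right.mono
      Finset.inter_subset_right Finset.inter_subset_right)] at hdc
    omega
  have hcover : ∀ u v : V, u ≠ v → ∃ d ∈ E, u ∈ d := by
    intro u v huv
    rcases (hconn u v).cases_head with h | ⟨_, ⟨d, hd, hud, _⟩, _⟩
    · exact absurd h huv
    · exact ⟨d, hd, hud⟩
  refine ⟨fun he => (exists_eq_pair_iff_card_inter A e).mpr (hcross e he), ?_⟩
  rintro ⟨u, hu, w, hw, rfl⟩
  have huw : u ≠ w := fun h => Finset.mem_compl.mp hw (h ▸ hu)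
  obtain ⟨c, hc, huc⟩ := hcover u w huw
  obtain ⟨d, hd, hwd⟩ := hcover w u huw.symm
  have hcA : {u} = c ∩ A := Finset.eq_of_subset_of_card_le (by simp [huc, hu])
    (by simp [(hcross c hc).1])
  have hdA : {w} = d ∩ Aᶜ := Finset.eq_of_subset_of_card_le
    (Finset.singleton_subset_iff.mpr (Finset.mem_inter.mpr ⟨hwd, hw⟩))
    (by simp [(hcross d hd).2])
  have hmem := inter_union_inter_mem_of_excState_separable hfg hc hd
  rwa [← hcA, ← hdA] at hmem

/-- For a connected graph G = (V,E) and a partition of the vertices into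
nonempty sets V₁ and V₂ = V₁ᶜ, the excitation state |G⟩ is separable across V₁|V₂ iff
G is the complete bipartite graph K_{V₁,V₂}; and in that case |G⟩ factors as a
product of two W states. -/
theorem excState_graph_separable_iff_completeBipartite {V : Type} [Fintype V]
    [DecidableEq V] (E : Finset (Finset V)) (hEne : E.Nonempty)
    (hunif : ∀ e ∈ E, e.card = 2)
    (hconn : ∀ u v : V,
      Relation.ReflTransGen (fun a b => ∃ e ∈ E, a ∈ e ∧ b ∈ e) u v)
    (V₁ : Finset V) (hV₁ : V₁.Nonempty) (hV₂ : V₁ᶜ.Nonempty) :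
    ((∃ (f : ({v // v ∈ V₁} → Fin 2) → ℂ) (g : ({v // v ∈ V₁ᶜ} → Fin 2) → ℂ),
        ∀ x : V → Fin 2,
          excState E x = f (fun v => x v.1) * g (fun v => x v.1)) ↔
      (∀ e : Finset V, e ∈ E ↔ ∃ u ∈ V₁, ∃ w ∈ V₁ᶜ, e = {u, w})) ∧
    ((∀ e : Finset V, e ∈ E ↔ ∃ u ∈ V₁, ∃ w ∈ V₁ᶜ, e = {u, w}) →
      ∀ x : V → Fin 2,
        excState E x =
          Wstate {v // v ∈ V₁} (fun v => x v.1) *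
          Wstate {v // v ∈ V₁ᶜ} (fun v => x v.1)) := by
  exact ⟨⟨fun ⟨_, _, hfg⟩ => completeBipartite_of_excState_separable hunif hconn hV₁ hV₂ hfg,
    fun hE => ⟨_, _, excState_completeBipartite hE⟩⟩, excState_completeBipartite⟩
end

section
/- Let G = (V,E) be a k-uniform hypergraph with N = |V| vertices and let v ∈ V. Let ρ_v be the one-qubit reduced density matrix of the excitation state |G⟩ at v, and define the generalized concurrence C_{v|rest} = 2·√(det ρ_v). Then C_{v|rest}² = 4·d_v·(|E| − d_v)/|E|². If moreover G is regular, i.e. all vertices have the same degree, then C_{v|rest}² = 4·k·(N−k)/N². -/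
open scoped ComplexConjugate

/-- The one-qubit reduced density matrix of a multi-qubit state at the vertex `v`. -/
noncomputable def rhoOne {V : Type} [Fintype V] [DecidableEq V] (v : V)
    (ψ : (V → Fin 2) → ℂ) : Matrix (Fin 2) (Fin 2) ℂ :=
  fun x y => ∑ z : {u // u ≠ v} → Fin 2,
    ψ (fun u => if h : u = v then x else z ⟨u, h⟩) *
    conj (ψ (fun u => if h : u = v then y else z ⟨u, h⟩))

/-- Degree of a vertex: number of edges containing it. -/
def hdeg {V : Type} [DecidableEq V] (E : Finset (Finset V)) (v : V) : ℕ :=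
  (E.filter (fun e => v ∈ e)).card

/-- The support of the bit string obtained by putting `x` at `v` and `z` elsewhere. -/
def glueSupport {V : Type} [Fintype V] [DecidableEq V] (v : V) (x : Fin 2)
    (z : {u // u ≠ v} → Fin 2) : Finset V :=
  Finset.univ.filter (fun u => (if h : u = v then x else z ⟨u, h⟩) = 1)

lemma mem_glueSupport_self {V : Type} [Fintype V] [DecidableEq V] (v : V) (x : Fin 2)
    (z : {u // u ≠ v} → Fin 2) : v ∈ glueSupport v x z ↔ x = 1 := by
  simp [glueSupport]

lemma mem_glueSupport_of_ne {V : Type} [Fintype V] [DecidableEq V] {v u : V} (h : u ≠ v)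
    (x : Fin 2) (z : {u // u ≠ v} → Fin 2) : u ∈ glueSupport v x z ↔ z ⟨u, h⟩ = 1 := by
  simp [glueSupport, h]

lemma glueSupport_one {V : Type} [Fintype V] [DecidableEq V] (v : V)
    (z : {u // u ≠ v} → Fin 2) : glueSupport v 1 z = insert v (glueSupport v 0 z) := by
  ext u
  by_cases h : u = v
  · subst h
    simp [mem_glueSupport_self]
  · simp [mem_glueSupport_of_ne h, h]

lemma card_glueSupport_one {V : Type} [Fintype V] [DecidableEq V] (v : V)
    (z : {u // u ≠ v} → Fin 2) :
    (glueSupport v 1 z).card = (glueSupport v 0 z).card + 1 := by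
  rw [glueSupport_one, Finset.card_insert_of_notMem]
  simp [mem_glueSupport_self]

lemma card_filter_glueSupport_mem {V : Type} [Fintype V] [DecidableEq V]
    (E : Finset (Finset V)) (v : V) (x : Fin 2) :
    (Finset.univ.filter (fun z => glueSupport v x z ∈ E)).card =
      (E.filter (fun e => v ∈ e ↔ x = 1)).card := by
  refine Finset.card_bij (fun z _ => glueSupport v x z) ?_ ?_ ?_
  · intro z hz
    simpa [mem_glueSupport_self] using hz
  · intro z _ w _ h
    funext ⟨u, hu⟩
    have hiff : z ⟨u, hu⟩ = 1 ↔ w ⟨u, hu⟩ = 1 := by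
      rw [← mem_glueSupport_of_ne hu x z, ← mem_glueSupport_of_ne hu x w, h]
    generalize z ⟨u, hu⟩ = a at *
    generalize w ⟨u, hu⟩ = b at *
    revert a b
    decide
  · intro e he
    rw [Finset.mem_filter] at he
    have key : glueSupport v x (fun u => if u.1 ∈ e then 1 else 0) = e := by
      ext u
      by_cases h : u = v
      · subst h
        rw [mem_glueSupport_self, he.2]
      · simp [mem_glueSupport_of_ne h]
    exact ⟨_, by simpa [key] using he.1, key⟩

lemma rhoOne_excState_apply {V : Type} [Fintype V] [DecidableEq V]
    (E : Finset (Finset V)) (v : V) (x y : Fin 2) :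
    rhoOne v (excState E) x y =
      ((Finset.univ.filter
        (fun z => glueSupport v x z ∈ E ∧ glueSupport v y z ∈ E)).card : ℂ) / E.card := by
  have hsq : ((Real.sqrt E.card : ℂ))⁻¹ * ((Real.sqrt E.card : ℂ))⁻¹ = (E.card : ℂ)⁻¹ := by
    rw [← mul_inv, ← Complex.ofReal_mul, Real.mul_self_sqrt (Nat.cast_nonneg _)]
    simp
  have hterm : ∀ z : {u // u ≠ v} → Fin 2,
      excState E (fun u => if h : u = v then x else z ⟨u, h⟩) *
        conj (excState E (fun u => if h : u = v then y else z ⟨u, h⟩)) =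
      if glueSupport v x z ∈ E ∧ glueSupport v y z ∈ E then (E.card : ℂ)⁻¹ else 0 := by
    intro z
    change (if glueSupport v x z ∈ E then _ else _) *
      conj (if glueSupport v y z ∈ E then _ else _) = _
    by_cases hx : glueSupport v x z ∈ E <;> by_cases hy : glueSupport v y z ∈ E <;>
      simp [hx, hy, hsq, Complex.conj_ofReal]
  rw [rhoOne, Finset.sum_congr rfl fun z _ => hterm z, ← Finset.sum_filter, Finset.sum_const,
    nsmul_eq_mul, div_eq_mul_inv]

lemma rhoOne_excState_diag {V : Type} [Fintype V] [DecidableEq V]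
    (E : Finset (Finset V)) (v : V) (x : Fin 2) :
    rhoOne v (excState E) x x =
      ((E.filter (fun e => v ∈ e ↔ x = 1)).card : ℂ) / E.card := by
  simp only [rhoOne_excState_apply, and_self, card_filter_glueSupport_mem]

lemma rhoOne_excState_zero_one {V : Type} [Fintype V] [DecidableEq V] {k : ℕ}
    {E : Finset (Finset V)} (hunif : ∀ e ∈ E, e.card = k) (v : V) :
    rhoOne v (excState E) 0 1 = 0 := by
  rw [rhoOne_excState_apply, Finset.filter_false_of_mem]
  · simp
  · rintro z - ⟨h0, h1⟩
    have := card_glueSupport_one v z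
    rw [hunif _ h0, hunif _ h1] at this
    omega

lemma card_filter_notMem_add_hdeg {V : Type} [DecidableEq V] (E : Finset (Finset V)) (v : V) :
    (E.filter (fun e => v ∉ e)).card + hdeg E v = E.card := by
  rw [hdeg, add_comm]
  exact Finset.card_filter_add_card_filter_not _

lemma det_rhoOne_excState {V : Type} [Fintype V] [DecidableEq V] {k : ℕ}
    {E : Finset (Finset V)} (hunif : ∀ e ∈ E, e.card = k) (v : V) :
    (rhoOne v (excState E)).det =
      ((hdeg E v * (E.card - hdeg E v) / (E.card : ℝ) ^ 2 : ℝ) : ℂ) := by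
  have h : ((E.filter (fun e => v ∉ e)).card : ℂ) = E.card - hdeg E v := by
    rw [← card_filter_notMem_add_hdeg E v]
    push_cast
    ring
  rw [Matrix.det_fin_two, rhoOne_excState_zero_one hunif, rhoOne_excState_diag,
    rhoOne_excState_diag]
  simp only [zero_ne_one, iff_false, iff_true, h]
  rw [← hdeg]
  push_cast
  ring

lemma hdeg_le_card {V : Type} [DecidableEq V] (E : Finset (Finset V)) (v : V) :
    hdeg E v ≤ E.card :=
  Finset.card_filter_le _ _

/-- Handshake lemma for uniform hypergraphs. -/
lemma sum_hdeg {V : Type} [Fintype V] [DecidableEq V] {k : ℕ}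
    {E : Finset (Finset V)} (hunif : ∀ e ∈ E, e.card = k) :
    ∑ u, hdeg E u = E.card * k := by
  have h := Finset.sum_card_bipartiteAbove_eq_sum_card_bipartiteBelow
    (s := (Finset.univ : Finset V)) (t := E) (fun u e => u ∈ e)
  simp only [Finset.bipartiteAbove, Finset.bipartiteBelow, Finset.filter_univ_mem] at h
  simp only [hdeg]
  rw [h, Finset.sum_congr rfl hunif, Finset.sum_const, smul_eq_mul]

/-- For a k-uniform hypergraph G = (V,E) with N = |V| vertices and a
vertex v, the generalized concurrence C_{v|rest} = 2√(det ρ_v) of the excitation state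
satisfies C² = 4·d_v·(|E|−d_v)/|E|², and if G is regular, C² = 4·k·(N−k)/N². -/
theorem genConcurrence_excState {V : Type} [Fintype V] [DecidableEq V]
    (k : ℕ) (E : Finset (Finset V)) (hEne : E.Nonempty)
    (hedge : ∀ e ∈ E, e.Nonempty) (hunif : ∀ e ∈ E, e.card = k) (v : V) :
    (2 * Real.sqrt ((rhoOne v (excState E)).det.re)) ^ 2 =
      4 * (hdeg E v : ℝ) * ((E.card : ℝ) - (hdeg E v : ℝ)) / (E.card : ℝ) ^ 2 ∧
    ((∀ u u' : V, hdeg E u = hdeg E u') →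
      (2 * Real.sqrt ((rhoOne v (excState E)).det.re)) ^ 2 =
        4 * (k : ℝ) * ((Fintype.card V : ℝ) - (k : ℝ)) / (Fintype.card V : ℝ) ^ 2) := by
  have hE : (E.card : ℝ) ≠ 0 := by
    exact_mod_cast hEne.card_pos.ne'
  have hN : (Fintype.card V : ℝ) ≠ 0 := by
    exact_mod_cast (Fintype.card_pos_iff.mpr ⟨v⟩).ne'
  have hle : (hdeg E v : ℝ) ≤ E.card := by
    exact_mod_cast hdeg_le_card E v
  have hmain : (2 * Real.sqrt ((rhoOne v (excState E)).det.re)) ^ 2 =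
      4 * (hdeg E v : ℝ) * ((E.card : ℝ) - (hdeg E v : ℝ)) / (E.card : ℝ) ^ 2 := by
    rw [det_rhoOne_excState hunif, Complex.ofReal_re, mul_pow, Real.sq_sqrt]
    · ring
    · have := sub_nonneg.mpr hle
      positivity
  refine ⟨hmain, fun hreg => ?_⟩
  have hshake : (Fintype.card V : ℝ) * hdeg E v = E.card * k := by
    have h := sum_hdeg hunif
    rw [Finset.sum_congr rfl fun u _ => hreg u v, Finset.sum_const, smul_eq_mul,
      Finset.card_univ] at h
    exact_mod_cast h
  have hd : (hdeg E v : ℝ) = E.card * k / Fintype.card V := by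
    rw [eq_div_iff hN, mul_comm, hshake]
  rw [hmain, hd]
  field_simp
end

section
/- Let d ≥ 2 and let k, N be integers with 2k < N, and let ψ and φ be two k-uniform states of N qudits with d levels, both of minimal support. Then ψ and φ are SLOCC-equivalent — i.e. there exist invertible d×d matrices O_1,…,O_N and a nonzero complex number κ with (O_1⊗⋯⊗O_N)ψ = κ·φ — if and only if they are LM-equivalent, i.e. such O_i can be chosen so that every O_i is a monomial matrix. Likewise, ψ and φ are LU-equivalent if and only if there exist monomial unitary matrices U_1,…,U_N with (U_1⊗⋯⊗U_N)ψ = φ. -/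
open scoped ComplexConjugate

/-- `ψ` is `k`-uniform: every `k`-party reduced density matrix is maximally mixed. -/
def IsKUniform (N d k : ℕ) (ψ : (Fin N → Fin d) → ℂ) : Prop :=
  ∀ S : Finset (Fin N), S.card = k →
    rdm S ψ = (((d : ℂ) ^ k)⁻¹) •
      (1 : Matrix ({i // i ∈ S} → Fin d) ({i // i ∈ S} → Fin d) ℂ)

/-- The support of a state: the set of basis labels with nonzero coefficient. -/
noncomputable def stateSupport {α : Type} [Fintype α] (ψ : α → ℂ) : Finset α :=
  @Finset.filter _ (fun x => ψ x ≠ 0) (Classical.decPred _) Finset.univ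

/-- Action of the local operator `O_1 ⊗ ⋯ ⊗ O_N` on a multipartite state. -/
noncomputable def applyLocal {ι α : Type} [Fintype ι] [DecidableEq ι] [Fintype α]
    [DecidableEq α] (O : ι → Matrix α α ℂ) (ψ : (ι → α) → ℂ) : (ι → α) → ℂ :=
  fun x => ∑ y : ι → α, (∏ i, O i (x i) (y i)) * ψ y

/-- A monomial matrix: exactly one nonzero entry in every row and every column. -/
def IsMonomial {α : Type} [Fintype α] (M : Matrix α α ℂ) : Prop :=
  (∀ i, ∃! j, M i j ≠ 0) ∧ (∀ j, ∃! i, M i j ≠ 0)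

/-- Matrix of the local operator `⨂ i, O i` in the computational basis. -/
def localMatrix {ι α : Type} [Fintype ι] (O : ι → Matrix α α ℂ) : Matrix (ι → α) (ι → α) ℂ :=
  fun x y => ∏ i, O i (x i) (y i)

section LocalMatrix

variable {ι α : Type} [Fintype ι]

lemma localMatrix_mul [DecidableEq ι] [Fintype α] (O O' : ι → Matrix α α ℂ) :
    localMatrix O * localMatrix O' = localMatrix (fun i => O i * O' i) := by
  ext x y
  simp only [localMatrix, Matrix.mul_apply, ← Finset.prod_mul_distrib]
  rw [Finset.prod_univ_sum, Fintype.piFinset_univ]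

lemma localMatrix_one [DecidableEq α] : localMatrix (fun _ : ι => (1 : Matrix α α ℂ)) = 1 := by
  ext x y
  simp only [localMatrix, Matrix.one_apply, Fintype.prod_boole, funext_iff]

lemma isUnit_localMatrix [DecidableEq ι] [Fintype α] [DecidableEq α]
    {O : ι → Matrix α α ℂ} (hO : ∀ i, IsUnit (O i)) :
    IsUnit (localMatrix O) := by
  refine IsUnit.of_mul_eq_one (localMatrix fun i => (O i)⁻¹) ?_
  rw [localMatrix_mul, ← localMatrix_one]
  congr 1
  ext1 i
  exact Matrix.mul_nonsing_inv _ ((Matrix.isUnit_iff_isUnit_det _).1 (hO i))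

/-- Entries of the local operator acting as the rank-one matrix `e_a vᵀ` at the single party `i`. -/
lemma localMatrix_update_vecMulVec [DecidableEq ι] [DecidableEq α] (i : ι) (a : α) (v : α → ℂ)
    (x y : ι → α) :
    localMatrix (Function.update (fun _ => (1 : Matrix α α ℂ)) i
      (Matrix.vecMulVec (Pi.single a 1) v)) x y =
      if x = Function.update y i a then v (y i) else 0 := by
  rw [localMatrix, ← Finset.mul_prod_erase _ _ (Finset.mem_univ i)]
  have h : ∏ j ∈ Finset.univ.erase i, Function.update (fun _ => (1 : Matrix α α ℂ)) i
      (Matrix.vecMulVec (Pi.single a 1) v) j (x j) (y j) =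
      ∏ j ∈ Finset.univ.erase i, if x j = y j then (1 : ℂ) else 0 := by
    refine Finset.prod_congr rfl fun j hj => ?_
    rw [Function.update_of_ne (Finset.ne_of_mem_erase hj), Matrix.one_apply]
  rw [h, Finset.prod_boole, Function.update_self, Matrix.vecMulVec_apply, Pi.single_apply]
  simp only [Function.eq_update_iff, Finset.mem_erase, Finset.mem_univ, and_true]
  split_ifs <;> simp_all

end LocalMatrix

lemma rank_diagonal_mul_boole {m n : Type} [Fintype m] [DecidableEq m] [Fintype n]
    [DecidableEq n] (w : m → ℂ) {g : m → n} (hg : Function.Injective g) :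
    (Matrix.of fun x z => if z = g x then w x else 0 : Matrix m n ℂ).rank =
      Nat.card {x // w x ≠ 0} := by
  classical
  set P : Matrix m n ℂ := Matrix.of fun x z => if z = g x then 1 else 0
  have hA : (Matrix.of fun x z => if z = g x then w x else 0 : Matrix m n ℂ) =
      Matrix.diagonal w * P := by
    ext x z
    simp [P, Matrix.diagonal_mul]
  have hP : P * P.transpose = 1 := by
    ext x y
    simp [P, Matrix.mul_apply, Matrix.one_apply, hg.eq_iff, eq_comm]
  rw [hA, Nat.card_eq_fintype_card, ← Matrix.rank_diagonal]
  refine le_antisymm (Matrix.rank_mul_le_left _ _) ?_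
  calc (Matrix.diagonal w).rank = (Matrix.diagonal w * P * P.transpose).rank := by
        rw [Matrix.mul_assoc, hP, Matrix.mul_one]
    _ ≤ _ := Matrix.rank_mul_le_left _ _

section Bipartition

variable {N d : ℕ}

/-- Labels of all parties correspond to pairs of labels of `S` and of its complement. -/
def glueEquiv (S : Finset (Fin N)) :
    (({i // i ∈ S} → Fin d) × ({i // i ∈ Sᶜ} → Fin d)) ≃ (Fin N → Fin d) where
  toFun p := glue S p.1 p.2
  invFun x := (fun i => x i, fun i => x i)
  left_inv p := by
    ext i
    · simp [glue]
    · have := Finset.mem_compl.1 i.2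
      simp [glue, this]
  right_inv x := by
    ext i
    simp [glue]

lemma glue_apply_mem (S : Finset (Fin N)) (x : {i // i ∈ S} → Fin d)
    (z : {i // i ∈ Sᶜ} → Fin d) (i : {i // i ∈ S}) : glue S x z i = x i := by
  simp [glue]

lemma glue_apply_compl (S : Finset (Fin N)) (x : {i // i ∈ S} → Fin d)
    (z : {i // i ∈ Sᶜ} → Fin d) (i : {i // i ∈ Sᶜ}) : glue S x z i = z i := by
  have := Finset.mem_compl.1 i.2
  simp [glue, this]

lemma glue_eq_iff (S : Finset (Fin N)) (x : {i // i ∈ S} → Fin d)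
    (z : {i // i ∈ Sᶜ} → Fin d) (y : Fin N → Fin d) :
    glue S x z = y ↔ x = (fun i : {i // i ∈ S} => y i) ∧ z = fun i : {i // i ∈ Sᶜ} => y i := by
  have := (glueEquiv S).eq_symm_apply (y := (x, z)) (x := y)
  rw [Prod.ext_iff] at this
  exact this.symm

/-- The coefficients of a state as a matrix across the bipartition `S`, `Sᶜ`. -/
def cutMatrix (S : Finset (Fin N)) (ψ : (Fin N → Fin d) → ℂ) :
    Matrix ({i // i ∈ S} → Fin d) ({i // i ∈ Sᶜ} → Fin d) ℂ :=
  fun x z => ψ (glue S x z)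

lemma cutMatrix_applyLocal (S : Finset (Fin N)) (O : Fin N → Matrix (Fin d) (Fin d) ℂ)
    (ψ : (Fin N → Fin d) → ℂ) :
    cutMatrix S (applyLocal O ψ) =
      localMatrix (fun i : {i // i ∈ S} => O i) * cutMatrix S ψ *
        (localMatrix fun i : {i // i ∈ Sᶜ} => O i).transpose := by
  ext x z
  simp only [cutMatrix, applyLocal, Matrix.mul_apply, Matrix.transpose_apply, localMatrix,
    Finset.sum_mul]
  rw [← (glueEquiv S).sum_comp, Fintype.sum_prod_type_right]
  refine Finset.sum_congr rfl fun z' _ => Finset.sum_congr rfl fun x' _ => ?_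
  have h : ∏ i, O i (glue S x z i) (glue S x' z' i) =
      (∏ i : {i // i ∈ S}, O i (x i) (x' i)) * ∏ i : {i // i ∈ Sᶜ}, O i (z i) (z' i) := by
    rw [← Finset.prod_mul_prod_compl S, ← Finset.prod_coe_sort S, ← Finset.prod_coe_sort Sᶜ]
    simp only [glue_apply_mem, glue_apply_compl]
  change (∏ i, O i (glue S x z i) (glue S x' z' i)) * ψ (glue S x' z') = _
  rw [h]
  ring

end Bipartition

lemma mem_stateSupport {α : Type} [Fintype α] {ψ : α → ℂ} {x : α} :
    x ∈ stateSupport ψ ↔ ψ x ≠ 0 := by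
  simp [stateSupport]

section MinimalSupport

variable {N d k : ℕ} {ψ φ : (Fin N → Fin d) → ℂ}

/-- Restricting the support of a `k`-uniform state of minimal support to `k` parties is
bijective. -/
lemma bijective_restrict_support (hd : d ≠ 0) (hψ : IsKUniform N d k ψ)
    (hs : (stateSupport ψ).card = d ^ k) {S : Finset (Fin N)} (hS : S.card = k) :
    Function.Bijective
      (fun (c : {x // x ∈ stateSupport ψ}) (i : {i // i ∈ S}) => c.1 i) := by
  rw [Fintype.bijective_iff_surjective_and_card]
  refine ⟨fun x => ?_, by simp [hs, hS]⟩
  have h := congrFun (congrFun (hψ S hS) x) x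
  have hne : rdm S ψ x x ≠ 0 := by
    rw [h]
    simp [hd]
  obtain ⟨z, -, hz⟩ := Finset.exists_ne_zero_of_sum_ne_zero hne
  refine ⟨⟨glue S x z, mem_stateSupport.2 (left_ne_zero_of_mul hz)⟩, ?_⟩
  ext1 i
  exact glue_apply_mem S x z i

lemma support_ext (hd : d ≠ 0) (hψ : IsKUniform N d k ψ)
    (hs : (stateSupport ψ).card = d ^ k) {T : Finset (Fin N)} (hT : k ≤ T.card)
    {x y : Fin N → Fin d} (hx : ψ x ≠ 0) (hy : ψ y ≠ 0) (hxy : ∀ i ∈ T, x i = y i) :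
    x = y := by
  obtain ⟨S, hST, hS⟩ := Finset.exists_subset_card_eq hT
  have := @(bijective_restrict_support hd hψ hs hS).1 ⟨x, mem_stateSupport.2 hx⟩
    ⟨y, mem_stateSupport.2 hy⟩ (funext fun i => hxy i (hST i.2))
  exact congrArg Subtype.val this

lemma rank_cutMatrix_mul_localMatrix (hkN : 2 * k < N) (hd : d ≠ 0)
    (hψ : IsKUniform N d k ψ) (hs : (stateSupport ψ).card = d ^ k) {S : Finset (Fin N)}
    (hS : S.card = k) (i : {i // i ∈ Sᶜ}) (a : Fin d) (v : Fin d → ℂ) :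
    (cutMatrix S ψ * (localMatrix (Function.update
      (fun _ => (1 : Matrix (Fin d) (Fin d) ℂ)) i
      (Matrix.vecMulVec (Pi.single a 1) v))).transpose).rank =
      Nat.card {c : {x // x ∈ stateSupport ψ} // v (c.1 i) ≠ 0} := by
  classical
  let e := Equiv.ofBijective _ (bijective_restrict_support hd hψ hs hS)
  have heS : ∀ x (j : {j // j ∈ S}), (e.symm x).1 j = x j := fun x j =>
    congrFun (e.apply_symm_apply x) j
  have hne : ∀ x, ψ (e.symm x).1 ≠ 0 := fun x => mem_stateSupport.1 (e.symm x).2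
  let g : ({j // j ∈ S} → Fin d) → ({j // j ∈ Sᶜ} → Fin d) := fun x =>
    Function.update (fun j => (e.symm x).1 j) i a
  have hg : Function.Injective g := by
    intro x y hxy
    apply e.symm.injective
    apply Subtype.ext
    refine support_ext hd hψ hs (T := Sᶜ.erase i) ?_ (hne x) (hne y) ?_
    · rw [Finset.card_erase_of_mem i.2, Finset.card_compl, Fintype.card_fin, hS]
      omega
    · intro j hj
      obtain ⟨hji, hjS⟩ := Finset.mem_erase.1 hj
      have := congrFun hxy ⟨j, hjS⟩
      have hne' : (⟨j, hjS⟩ : {j // j ∈ Sᶜ}) ≠ i := fun h => hji (congrArg Subtype.val h)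
      simpa [g, Function.update_of_ne hne'] using this
  have hA : cutMatrix S ψ * (localMatrix (Function.update
      (fun _ => (1 : Matrix (Fin d) (Fin d) ℂ)) i
      (Matrix.vecMulVec (Pi.single a 1) v))).transpose =
      Matrix.of fun x z => if z = g x then ψ (e.symm x).1 * v ((e.symm x).1 i) else 0 := by
    ext x z
    rw [Matrix.mul_apply, Finset.sum_eq_single fun j : {j // j ∈ Sᶜ} => (e.symm x).1 j]
    · have hx : glue S x (fun j : {j // j ∈ Sᶜ} => (e.symm x).1 j) = (e.symm x).1 :=
        (glue_eq_iff S _ _ _).2 ⟨funext fun j => (heS x j).symm, rfl⟩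
      rw [Matrix.transpose_apply, localMatrix_update_vecMulVec, cutMatrix, hx, Matrix.of_apply,
        mul_ite, mul_zero]
    · intro z' _ hz'
      rw [cutMatrix, mul_eq_zero]
      left
      by_contra h
      apply hz'
      have : e.symm x = ⟨glue S x z', mem_stateSupport.2 h⟩ := by
        rw [Equiv.symm_apply_eq]
        exact funext fun j => (glue_apply_mem S x z' j).symm
      rw [this]
      exact funext fun j => (glue_apply_compl S x z' j).symm
    · simp
  rw [hA, rank_diagonal_mul_boole _ hg]
  refine Nat.card_congr (e.symm.subtypeEquiv fun x => ?_)
  simp [hne x]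

lemma card_support_coord (hk : 1 ≤ k) (hkN : 2 * k < N) (hd : d ≠ 0)
    (hψ : IsKUniform N d k ψ) (hs : (stateSupport ψ).card = d ^ k) (i : Fin N)
    (v : Fin d → ℂ) :
    Nat.card {c : {x // x ∈ stateSupport ψ} // v (c.1 i) ≠ 0} =
      Nat.card {b // v b ≠ 0} * d ^ (k - 1) := by
  classical
  obtain ⟨T, hiT, -, hT⟩ := Finset.exists_subsuperset_card_eq (Finset.subset_univ {i})
    (n := k) (by simpa using hk) (by simp; omega)
  have hi : i ∈ T := Finset.singleton_subset_iff.1 hiT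
  let t : {j // j ∈ T} := ⟨i, hi⟩
  let e := (Equiv.ofBijective _ (bijective_restrict_support hd hψ hs hT)).trans
    (Equiv.funSplitAt t (Fin d))
  have h1 := Nat.card_congr (e.subtypeEquiv
    (p := fun c => v (c.1 i) ≠ 0) (q := fun p => v p.1 ≠ 0 ∧ True) fun c => by
      simp [e, t])
  rw [h1, Nat.card_congr (Equiv.subtypeProdEquivProd (p := fun b => v b ≠ 0)
    (q := fun _ => True)), Nat.card_prod]
  simp [hT, Fintype.card_subtype_compl]

lemma isMonomial_of_card_row {O : Matrix (Fin d) (Fin d) ℂ} (hO : IsUnit O)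
    (h : ∀ a, Nat.card {b // O a b ≠ 0} = 1) : IsMonomial O := by
  have hrow : ∀ a, ∃! b, O a b ≠ 0 := by
    intro a
    obtain ⟨hsub, ⟨b⟩⟩ := Nat.card_eq_one_iff_unique.1 (h a)
    exact ⟨b.1, b.2, fun c hc => congrArg Subtype.val (hsub.elim ⟨c, hc⟩ b)⟩
  choose σ hσ hσu using hrow
  have hsurj : Function.Surjective σ := by
    intro b
    by_contra! hb
    have hdet : O.det = 0 := Matrix.det_eq_zero_of_column_eq_zero b fun a => by
      by_contra hab
      exact hb a (hσu a b hab).symm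
    exact ((Matrix.isUnit_iff_isUnit_det _).1 hO).ne_zero hdet
  have hinj := Finite.injective_iff_surjective.2 hsurj
  refine ⟨fun a => ⟨σ a, hσ a, hσu a⟩, fun b => ?_⟩
  obtain ⟨a, rfl⟩ := hsurj b
  exact ⟨a, hσ a, fun c hc => hinj (hσu c _ hc).symm⟩

/-- For `k ≥ 1`, invertible local operators between such states are automatically monomial. -/
theorem isMonomial_of_applyLocal_eq (hk : 1 ≤ k) (hkN : 2 * k < N) (hd : d ≠ 0)
    (hψ : IsKUniform N d k ψ) (hφ : IsKUniform N d k φ)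
    (hψs : (stateSupport ψ).card = d ^ k) (hφs : (stateSupport φ).card = d ^ k)
    {O : Fin N → Matrix (Fin d) (Fin d) ℂ} {κ : ℂ} (hO : ∀ i, IsUnit (O i)) (hκ : κ ≠ 0)
    (h : applyLocal O ψ = κ • φ) (i : Fin N) : IsMonomial (O i) := by
  classical
  refine isMonomial_of_card_row (hO i) fun a => ?_
  obtain ⟨S, hSi, hS⟩ := Finset.exists_subset_card_eq (s := Finset.univ.erase i) (n := k)
    (by simp; omega)
  have hiS : i ∈ Sᶜ := Finset.mem_compl.2 fun hi => Finset.notMem_erase i _ (hSi hi)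
  let j : {j // j ∈ Sᶜ} := ⟨i, hiS⟩
  let one : {j // j ∈ Sᶜ} → Matrix (Fin d) (Fin d) ℂ := fun _ => 1
  let W : Matrix (Fin d) (Fin d) ℂ := Matrix.vecMulVec (Pi.single a 1) (Pi.single a 1)
  let O' : {j // j ∈ Sᶜ} → Matrix (Fin d) (Fin d) ℂ := Function.update (fun l => O l) j 1
  have hO' : ∀ l, IsUnit (O' l) := by
    intro l
    by_cases hl : l = j
    · subst hl; simp [O']
    · simp [O', Function.update_of_ne hl, hO]
  have hW : W * O i = Matrix.vecMulVec (Pi.single a 1) (O i a) := by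
    rw [Matrix.vecMulVec_mul]
    simp [Matrix.row]
  have hcomm : localMatrix (Function.update one j W) *
      localMatrix (fun l : {l // l ∈ Sᶜ} => O l) = localMatrix O' *
        localMatrix (Function.update one j (Matrix.vecMulVec (Pi.single a 1) (O i a))) := by
    rw [localMatrix_mul, localMatrix_mul]
    congr 1
    ext1 l
    by_cases hl : l = j
    · subst hl; simp [O', ← hW, j]
    · simp [O', Function.update_of_ne hl, one]
  have hcut : κ • (cutMatrix S φ * (localMatrix (Function.update one j W)).transpose) =
      localMatrix (fun l : {l // l ∈ S} => O l) * ((cutMatrix S ψ *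
        (localMatrix (Function.update one j
          (Matrix.vecMulVec (Pi.single a 1) (O i a)))).transpose) *
        (localMatrix O').transpose) := by
    have h2 : κ • cutMatrix S φ = cutMatrix S (applyLocal O ψ) := by rw [h]; rfl
    rw [← Matrix.smul_mul, h2, cutMatrix_applyLocal, Matrix.mul_assoc, ← Matrix.transpose_mul,
      hcomm, Matrix.transpose_mul]
    simp only [Matrix.mul_assoc]
  have hrank := congrArg Matrix.rank hcut
  have hK : IsUnit (localMatrix fun l : {l // l ∈ S} => O l).det :=
    (Matrix.isUnit_iff_isUnit_det _).1 (isUnit_localMatrix fun l => hO l)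
  have hK' : IsUnit (localMatrix O').transpose.det := by
    rw [Matrix.det_transpose]
    exact (Matrix.isUnit_iff_isUnit_det _).1 (isUnit_localMatrix hO')
  rw [Matrix.rank_mul_eq_right_of_isUnit_det _ _ hK, Matrix.rank_mul_eq_left_of_isUnit_det _ _ hK',
    Matrix.rank_smul_of_mem_nonZeroDivisors _ (mem_nonZeroDivisors_of_ne_zero hκ),
    rank_cutMatrix_mul_localMatrix hkN hd hψ hψs hS,
    rank_cutMatrix_mul_localMatrix hkN hd hφ hφs hS,
    card_support_coord hk hkN hd hψ hψs, card_support_coord hk hkN hd hφ hφs] at hrank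
  have hpos : 0 < d ^ (k - 1) := Nat.pow_pos (Nat.pos_of_ne_zero hd)
  rw [← Nat.eq_of_mul_eq_mul_right hpos hrank]
  simp [Pi.single_apply]

lemma exists_eq_single_of_card_support {α : Type} [Fintype α] [DecidableEq α] {ψ : α → ℂ}
    (hnorm : ∑ x, Complex.normSq (ψ x) = 1) (hs : (stateSupport ψ).card = 1) :
    ∃ x c, ‖c‖ = 1 ∧ ψ = Pi.single x c := by
  obtain ⟨x, hx⟩ := Finset.card_eq_one.1 hs
  have hψ : ψ = Pi.single x (ψ x) := by
    ext y
    by_cases hy : y = x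
    · subst hy; simp
    · have : y ∉ stateSupport ψ := by simp [hx, hy]
      simpa [mem_stateSupport, hy] using this
  refine ⟨x, ψ x, ?_, hψ⟩
  rw [Finset.sum_eq_single x (fun y _ hy => by rw [hψ]; simp [hy]) (by simp),
    Complex.normSq_eq_norm_sq] at hnorm
  exact (pow_eq_one_iff_of_nonneg (norm_nonneg _) two_ne_zero).1 hnorm

open Matrix in
lemma isMonomial_smul_permMatrix (σ : Equiv.Perm (Fin d)) {c : ℂ} (hc : ‖c‖ = 1) :
    IsMonomial (c • σ.permMatrix ℂ) ∧ (c • σ.permMatrix ℂ)ᴴ * (c • σ.permMatrix ℂ) = 1 := by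
  have hc0 : c ≠ 0 := by rintro rfl; simp at hc
  have happ : ∀ i j, (c • σ.permMatrix ℂ) i j = if σ i = j then c else 0 := by
    intro i j
    simp [Equiv.Perm.permMatrix, PEquiv.toMatrix_apply]
  refine ⟨⟨fun i => ⟨σ i, ?_, ?_⟩, fun j => ⟨σ.symm j, ?_, ?_⟩⟩, ?_⟩
  · simp [happ, hc0]
  · intro j; simp [happ, hc0, eq_comm]
  · simp [happ, hc0]
  · intro i; simp [happ, hc0, Equiv.eq_symm_apply]
  · ext i j
    rw [Matrix.mul_apply, Finset.sum_eq_single (σ.symm i)]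
    · rw [Matrix.conjTranspose_apply, happ, happ, Matrix.one_apply]
      have := Complex.conj_mul' c
      split_ifs <;> simp_all
    · intro l _ hl
      have : σ l ≠ i := fun h => hl (by simp [← h])
      rw [Matrix.conjTranspose_apply, happ]
      simp [this]
    · simp

/-- Two basis states, up to phases, are equivalent by local monomial unitaries. -/
lemma exists_monomial_unitary_single (hN : 0 < N) (x y : Fin N → Fin d) {a b : ℂ}
    (ha : ‖a‖ = 1) (hb : ‖b‖ = 1) :
    ∃ U : Fin N → Matrix (Fin d) (Fin d) ℂ,
      (∀ i, IsMonomial (U i) ∧ (U i).conjTranspose * U i = 1) ∧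
        applyLocal U (Pi.single x a) = Pi.single y b := by
  have ha0 : a ≠ 0 := by rintro rfl; simp at ha
  let c : Fin N → ℂ := Pi.mulSingle ⟨0, hN⟩ (b / a)
  have hc : ∀ i, ‖c i‖ = 1 := by
    intro i
    by_cases hi : i = ⟨0, hN⟩
    · subst hi; simp [c, ha, hb]
    · simp [c, Pi.mulSingle_eq_of_ne hi]
  have hcprod : ∏ i, c i = b / a := by simp [c]
  refine ⟨fun i => c i • (Equiv.swap (x i) (y i)).permMatrix ℂ,
    fun i => isMonomial_smul_permMatrix _ (hc i), ?_⟩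
  ext z
  rw [applyLocal, Finset.sum_eq_single x (fun w _ hw => by simp [hw]) (by simp)]
  have h : ∀ i, (c i • (Equiv.swap (x i) (y i)).permMatrix ℂ) (z i) (x i) =
      c i * if z i = y i then 1 else 0 := by
    intro i
    have : Equiv.swap (x i) (y i) (z i) = x i ↔ z i = y i := by
      rw [← Equiv.eq_symm_apply, Equiv.symm_swap, Equiv.swap_apply_left]
    simp [Equiv.Perm.permMatrix, PEquiv.toMatrix_apply, this]
  simp only [h, Finset.prod_mul_distrib, hcprod, Fintype.prod_boole, ← funext_iff,
    Pi.single_eq_same, Pi.single_apply]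
  split_ifs <;> simp [ha0]

end MinimalSupport

open Matrix in
/-- For 2k < N, two k-uniform states of N qudits of minimal support are
SLOCC-equivalent iff they are LM-equivalent (equivalent by local monomial invertible
matrices), and LU-equivalent iff they are equivalent by local monomial unitary
matrices. -/
theorem kUniform_minSupport_slocc_iff_lm (d k N : ℕ) (hd : 2 ≤ d) (hkN : 2 * k < N)
    (ψ φ : (Fin N → Fin d) → ℂ)
    (hψnorm : (∑ x, Complex.normSq (ψ x)) = 1)
    (hφnorm : (∑ x, Complex.normSq (φ x)) = 1)
    (hψuni : IsKUniform N d k ψ) (hφuni : IsKUniform N d k φ)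
    (hψsupp : (stateSupport ψ).card = d ^ k)
    (hφsupp : (stateSupport φ).card = d ^ k) :
    ((∃ (O : Fin N → Matrix (Fin d) (Fin d) ℂ) (κ : ℂ),
        (∀ i, IsUnit (O i)) ∧ κ ≠ 0 ∧ applyLocal O ψ = κ • φ) ↔
      (∃ (O : Fin N → Matrix (Fin d) (Fin d) ℂ) (κ : ℂ),
        (∀ i, IsUnit (O i) ∧ IsMonomial (O i)) ∧ κ ≠ 0 ∧ applyLocal O ψ = κ • φ)) ∧
    ((∃ U : Fin N → Matrix (Fin d) (Fin d) ℂ,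
        (∀ i, (U i)ᴴ * U i = 1) ∧ applyLocal U ψ = φ) ↔
      (∃ U : Fin N → Matrix (Fin d) (Fin d) ℂ,
        (∀ i, IsMonomial (U i) ∧ (U i)ᴴ * U i = 1) ∧ applyLocal U ψ = φ)) := by
  have hd0 : d ≠ 0 := by omega
  rcases Nat.eq_zero_or_pos k with rfl | hk
  · obtain ⟨x, a, ha, rfl⟩ := exists_eq_single_of_card_support hψnorm (by simpa using hψsupp)
    obtain ⟨y, b, hb, rfl⟩ := exists_eq_single_of_card_support hφnorm (by simpa using hφsupp)
    obtain ⟨U, hU, hUψ⟩ := exists_monomial_unitary_single (by omega) x y ha hb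
    refine ⟨⟨fun _ => ⟨U, 1, fun i => ⟨IsUnit.of_mul_eq_one_right _ (hU i).2, (hU i).1⟩,
      one_ne_zero, by rw [hUψ, one_smul]⟩, ?_⟩, ⟨fun _ => ⟨U, hU, hUψ⟩, ?_⟩⟩
    · rintro ⟨O, κ, hO, h⟩
      exact ⟨O, κ, fun i => (hO i).1, h⟩
    · rintro ⟨V, hV, h⟩
      exact ⟨V, fun i => (hV i).2, h⟩
  · refine ⟨⟨?_, ?_⟩, ⟨?_, ?_⟩⟩
    · rintro ⟨O, κ, hO, hκ, h⟩
      exact ⟨O, κ, fun i => ⟨hO i, isMonomial_of_applyLocal_eq hk hkN hd0 hψuni hφuni hψsupp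
        hφsupp hO hκ h i⟩, hκ, h⟩
    · rintro ⟨O, κ, hO, h⟩
      exact ⟨O, κ, fun i => (hO i).1, h⟩
    · rintro ⟨U, hU, h⟩
      refine ⟨U, fun i => ⟨isMonomial_of_applyLocal_eq hk hkN hd0 hψuni hφuni hψsupp
        hφsupp (fun i => IsUnit.of_mul_eq_one_right _ (hU i)) one_ne_zero
        (by rw [h, one_smul]) i, hU i⟩, h⟩
    · rintro ⟨U, hU, h⟩
      exact ⟨U, fun i => (hU i).2, h⟩
end
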